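/- Let C ⊂ [0,1] be the middle-third Cantor set and let μ be the Hausdorff measure of dimension log 2/log 3 restricted to C (a finite nonzero measure). Then for μ-almost every x ∈ C, the continued fraction expansion of x contains all patterns: for every finite sequence (b_1,…,b_k) of positive integers there exists m ≥ 0 with a_{m+i}(x) = b_i for all 1 ≤ i ≤ k. -/

import Mathlib

open MeasureTheory

/-- The Gauss map `G(x) = 1/x − ⌊1/x⌋`. -/
noncomputable def gaussMap (x : ℝ) : ℝ := Int.fract x⁻¹

/-- The `k`-th continued fraction coefficient `a_k(x) = ⌊1/G^(k−1)(x)⌋` (for `k ≥ 1`). -/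
noncomputable def cfCoeff (x : ℝ) (k : ℕ) : ℤ := ⌊(gaussMap^[k - 1] x)⁻¹⌋

/-- The continued fraction expansion of `x` contains all patterns: every finite sequence of
positive integers appears as a block of consecutive coefficients. -/
def ContainsAllPatterns (x : ℝ) : Prop :=
  ∀ (k : ℕ) (b : Fin k → ℕ), (∀ i, 0 < b i) →
    ∃ m : ℕ, ∀ i : Fin k, cfCoeff x (m + (i : ℕ) + 1) = (b i : ℤ)

/-- The middle-third Cantor set: reals in `[0,1]` admitting a base-3 expansion using only
the digits 0 and 2. -/
def middleThirdCantorSet : Set ℝ :=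
  {x | x ∈ Set.Icc (0 : ℝ) 1 ∧
    ∃ a : ℕ → ℕ, (∀ n, a n = 0 ∨ a n = 2) ∧ x = ∑' n : ℕ, (a n : ℝ) / 3 ^ (n + 1)}

/-! ### Continued fractions -/

/-- The open set of points of `(0, 1)` whose first continued fraction coefficients are `l`. -/
def cfCylinder : List ℕ → Set ℝ
  | [] => Set.Ioo 0 1
  | b :: l => Set.Ioo 0 1 ∩ (fun x : ℝ => x⁻¹ - b) ⁻¹' cfCylinder l

theorem cfCylinder_subset_Ioo : ∀ l, cfCylinder l ⊆ Set.Ioo 0 1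
  | [] => subset_rfl
  | _ :: _ => Set.inter_subset_left

theorem isOpen_cfCylinder : ∀ l, IsOpen (cfCylinder l)
  | [] => isOpen_Ioo
  | b :: l => by
    refine ContinuousOn.isOpen_inter_preimage ?_ isOpen_Ioo (isOpen_cfCylinder l)
    refine ContinuousOn.sub (ContinuousOn.inv₀ continuousOn_id ?_) continuousOn_const
    intro x hx
    exact hx.1.ne'

theorem cfCylinder_nonempty : ∀ l : List ℕ, (∀ b ∈ l, 0 < b) → (cfCylinder l).Nonempty
  | [], _ => ⟨1 / 2, by norm_num [cfCylinder]⟩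
  | b :: l, h => by
    obtain ⟨y, hy⟩ := cfCylinder_nonempty l fun c hc => h c (List.mem_cons_of_mem _ hc)
    have hy' := cfCylinder_subset_Ioo l hy
    have hb : (1 : ℝ) ≤ b := by exact_mod_cast h b List.mem_cons_self
    refine ⟨(y + b)⁻¹, ⟨inv_pos.2 (by linarith [hy'.1]), inv_lt_one_of_one_lt₀ ?_⟩, ?_⟩
    · linarith [hy'.1]
    · simpa using hy

theorem gaussMap_of_mem_Ioo {x : ℝ} {b : ℤ} (h : x⁻¹ - b ∈ Set.Ioo (0 : ℝ) 1) :
    gaussMap x = x⁻¹ - b :=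
  Int.fract_eq_iff.2 ⟨h.1.le, h.2, b, by ring⟩

theorem floor_iterate_gaussMap_of_mem_cfCylinder : ∀ (l : List ℕ) (x : ℝ), x ∈ cfCylinder l →
    ∀ (i : ℕ) (hi : i < l.length), ⌊(gaussMap^[i] x)⁻¹⌋ = (l[i] : ℤ)
  | [], _, _, i, hi => absurd hi (Nat.not_lt_zero i)
  | b :: l, x, hx, i, hi => by
    have h1 : x⁻¹ - b ∈ Set.Ioo (0 : ℝ) 1 := cfCylinder_subset_Ioo l hx.2
    cases i with
    | zero =>
      simp only [Function.iterate_zero, id_eq, List.getElem_cons_zero]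
      rw [Int.floor_eq_iff]
      push_cast
      constructor <;> linarith [h1.1, h1.2]
    | succ i =>
      have h2 : gaussMap x = x⁻¹ - b := gaussMap_of_mem_Ioo (b := (b : ℤ)) (by simpa using h1)
      rw [Function.iterate_succ_apply, h2]
      simpa using floor_iterate_gaussMap_of_mem_cfCylinder l _ hx.2 i (by simpa using hi)

theorem exists_iterate_gaussMap_eq_fract (N : ℕ) : ∀ (q p q' p' : ℤ), 1 ≤ q → q ≤ N → 0 ≤ q' →
    q' ≤ q → |p * q' - p' * q| = 1 → ∀ x : ℝ, Irrational x → 0 < x → x < 1 → ∀ α : ℝ, 2 < α →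
    x * (q * α + q') = p * α + p' → ∃ n, gaussMap^[n + 1] x = Int.fract α := by
  induction N with
  | zero => intro q p q' p' h1 h2; exact absurd h2 (by push_cast; omega)
  | succ N ih =>
    intro q p q' p' hq hqN hq0 hq' hdet x hx hx0 hx1 α hα hxα
    have key : ∀ c : ℤ, ∀ β : ℝ, 1 < β → Int.fract β = Int.fract α → x⁻¹ - c = β⁻¹ →
        ∃ n, gaussMap^[n + 1] x = Int.fract α := by
      intro c β hβ hβα h
      refine ⟨1, ?_⟩
      have h1 : gaussMap x = x⁻¹ - c := gaussMap_of_mem_Ioo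
        (by rw [h]; exact ⟨by positivity, inv_lt_one_of_one_lt₀ hβ⟩)
      simp only [Function.iterate_succ, Function.iterate_zero, Function.comp_apply, id_eq, h1, h]
      rw [gaussMap, inv_inv, hβα]
    have hpos : (0 : ℝ) < q * α + q' := by
      have : (1 : ℝ) ≤ q := by exact_mod_cast hq
      have : (0 : ℝ) ≤ q' := by exact_mod_cast hq0
      nlinarith
    rcases hq.eq_or_lt with rfl | hq2
    · have hq'01 : q' = 0 ∨ q' = 1 := by omega
      have hcases : p' = p * q' - 1 ∨ p' = p * q' + 1 := by
        rcases (abs_eq zero_le_one).1 hdet with h | h <;> [left; right] <;> linarith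
      push_cast at *
      have hx' : x = (p * α + p') / (α + q') := by
        rw [eq_div_iff (by linarith)]; linarith
      have hx2 : x = p + (p' - p * q') / (α + q') := by
        rw [hx']; field_simp [show α + (q' : ℝ) ≠ 0 by linarith]; ring
      have hsmall : 0 < 1 / (α + (q' : ℝ)) ∧ 1 / (α + (q' : ℝ)) < 1 := by
        refine ⟨by apply one_div_pos.2; linarith, ?_⟩
        have : (0 : ℝ) ≤ q' := by exact_mod_cast hq0
        rw [div_lt_one] <;> linarith
      rcases hcases with h | h
      · have hx3 : x = p - 1 / (α + q') := by rw [hx2, h]; push_cast; ring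
        have hp : p = 1 := by
          have h1 : (0 : ℝ) < p := by linarith
          have h2 : (p : ℝ) < 2 := by linarith
          have h1 : 0 < p := by exact_mod_cast h1
          have h2 : p < 2 := by exact_mod_cast h2
          omega
        subst hp
        have hb : 1 < α + q' - 1 := by
          have : (0 : ℝ) ≤ q' := by exact_mod_cast hq0
          linarith
        refine key 1 (α + q' - 1) hb ?_ ?_
        · rw [show α + q' - 1 = α + ((q' - 1 : ℤ) : ℝ) by push_cast; ring, Int.fract_add_intCast]
        · rw [hx3]
          have h1 : α + q' ≠ 0 := by linarith
          have h2 : α + q' - 1 ≠ 0 := by linarith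
          rw [show ((1 : ℤ) : ℝ) - 1 / (α + q') = (α + q' - 1) / (α + q') by
            push_cast; field_simp, inv_div]
          push_cast
          field_simp
          ring
      · have hx3 : x = p + 1 / (α + q') := by rw [hx2, h]; push_cast; ring
        have hp : p = 0 := by
          have h1 : (-1 : ℝ) < p := by linarith
          have h2 : (p : ℝ) < 1 := by linarith
          have h1 : -1 < p := by exact_mod_cast h1
          have h2 : p < 1 := by exact_mod_cast h2
          omega
        subst hp
        refine ⟨0, ?_⟩
        simp only [zero_add, Function.iterate_one, gaussMap, hx3]
        simp
    · have hdet' : p * q' - p' * q = 1 ∨ p * q' - p' * q = -1 := (abs_eq zero_le_one).1 hdet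
      have hqR : (2 : ℝ) ≤ q := by exact_mod_cast hq2
      have hq0R : (0 : ℝ) ≤ q' := by exact_mod_cast hq0
      have herr : (q * x - p) * (q * α + q') = -(p * q' - p' * q : ℤ) := by
        push_cast
        linear_combination (q : ℝ) * hxα
      have hbound : |q * x - p| < 1 / 2 := by
        have h4 : 4 < q * α + q' := by nlinarith
        have h5 : |q * x - p| * (q * α + q') = 1 := by
          rw [show |q * x - p| * (q * α + q') = |(q * x - p) * (q * α + q')| by
            rw [abs_mul, abs_of_pos hpos], herr, abs_neg, ← Int.cast_abs, hdet]
          simp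
        by_contra! h
        nlinarith
      rw [abs_lt] at hbound
      have hp0 : 0 ≤ p := by
        have : (-1 : ℝ) < p := by nlinarith
        have : -1 < p := by exact_mod_cast this
        omega
      have hpq : p ≤ q := by
        have : (p : ℝ) < q + 1 := by nlinarith
        have : p < q + 1 := by exact_mod_cast this
        omega
      have hp1 : p ≠ 0 := by
        rintro rfl
        rw [zero_mul, zero_sub, abs_neg, abs_mul, abs_of_pos (by omega : 0 < q)] at hdet
        have := Int.eq_one_of_mul_eq_one_left (by omega) hdet
        omega
      have hpq' : p ≠ q := by
        rintro rfl
        rw [show p * q' - p' * p = (q' - p') * p by ring, abs_mul,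
          abs_of_pos (by omega : 0 < p)] at hdet
        have := Int.eq_one_of_mul_eq_one_left (by omega) hdet
        omega
      have hp'0 : 0 ≤ p' := by
        by_contra! h
        have h1 : 0 ≤ p * q' := mul_nonneg hp0 hq0
        have h2 : p' * q ≤ -2 := by nlinarith
        omega
      have hp'p : p' ≤ p := by
        by_contra! h
        have h1 : p * q' ≤ p * q := mul_le_mul_of_nonneg_left hq' hp0
        have h2 : p * q + 2 ≤ p' * q := by nlinarith
        omega
      set a : ℤ := ⌊x⁻¹⌋ with ha
      have hG : gaussMap x = x⁻¹ - a := by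
        rw [gaussMap, ha]; exact (Int.self_sub_floor _).symm
      have hGi : Irrational (gaussMap x) := by
        rw [hG]; exact (irrational_inv_iff.2 hx).sub_intCast a
      have hG0 : 0 ≤ gaussMap x := Int.fract_nonneg _
      have hG1 : gaussMap x < 1 := Int.fract_lt_one _
      obtain ⟨n, hn⟩ := ih p (q - a * p) p' (q' - a * p') (by omega) (by push_cast at hqN; omega)
        hp'0 hp'p (by rw [← hdet, ← abs_neg]; congr 1; ring) (gaussMap x) hGi
        (lt_of_le_of_ne hG0 fun h => hGi.ne_zero h.symm) hG1 α hα (by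
          rw [hG, ← hxα]
          push_cast
          have : x⁻¹ * x = 1 := inv_mul_cancel₀ hx0.ne'
          linear_combination (q * α + q') * this - (a : ℝ) * hxα)
      exact ⟨n + 1, by rw [Function.iterate_succ_apply, hn]⟩

theorem exists_pattern_of_approx {x : ℝ} (hx : Irrational x) (hx0 : 0 < x) (hx1 : x < 1)
    {p q p' q' σ z : ℤ} (hσ : σ = 1 ∨ σ = -1) (hdet : p * q' - p' * q = -σ) (hq : 0 < q)
    (hpos : 0 < σ * (q * x - p)) (hsmall : q * |q * x - p| < 1 / 3) {l : List ℕ}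
    (hl : (p' - q' * x) / (q * x - p) - z ∈ cfCylinder l) :
    ∃ m, ∀ (i : ℕ) (hi : i < l.length), cfCoeff x (m + i + 1) = (l[i] : ℤ) := by
  set k := q' / q
  set r := q' % q
  have hr0 : 0 ≤ r := Int.emod_nonneg _ hq.ne'
  have hrq : r < q := Int.emod_lt_of_pos _ hq
  have hqk : q' = r + q * k := by rw [add_comm]; exact (Int.mul_ediv_add_emod q' q).symm
  have hne : q * x - p ≠ 0 := by
    rintro h; rw [h] at hpos; simp at hpos
  have hqR : (0 : ℝ) < q := by exact_mod_cast hq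
  set α := (p' - q' * x) / (q * x - p) + k with hα
  have hdetR : (p * q' - p' * q : ℝ) = -σ := by exact_mod_cast hdet
  have hqkR : (q' : ℝ) = r + q * k := by exact_mod_cast hqk
  have habs : |q * x - p| = σ * (q * x - p) := by
    rcases hσ with rfl | rfl
    · rw [abs_of_pos] <;> push_cast at * <;> linarith
    · rw [abs_of_neg] <;> push_cast at * <;> linarith
  have hσ2 : (σ * σ : ℝ) = 1 := by rcases hσ with rfl | rfl <;> norm_num
  have hα' : α = 1 / (q * |q * x - p|) - r / q := by
    have hσ0 : (σ : ℝ) ≠ 0 := by rintro h; rw [h] at hσ2; simp at hσ2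
    rw [hα, habs]
    rw [show 1 / (q * (σ * (q * x - p))) = σ / (q * (q * x - p)) by
      rw [div_eq_div_iff (by positivity) (by positivity)]; linear_combination -(q * (q * x - p)) * hσ2]
    rw [eq_sub_iff_add_eq, eq_div_iff (by positivity)]
    have h1 : (p' - q' * x) / (q * x - p) * (q * x - p) = p' - q' * x := div_mul_cancel₀ _ hne
    have h2 : (r : ℝ) / q * q = r := div_mul_cancel₀ _ hqR.ne'
    linear_combination (q : ℝ) * h1 + (q * x - p) * h2 - (q * x - p) * hqkR - hdetR
  have hα2 : 2 < α := by
    have h1 : 3 < 1 / (q * |q * x - p|) := by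
      rw [lt_div_iff₀ (mul_pos hqR (abs_pos.2 hne))]; linarith
    have h2 : (r : ℝ) / q < 1 := by
      rw [div_lt_one hqR]; exact_mod_cast hrq
    linarith
  obtain ⟨n, hn⟩ := exists_iterate_gaussMap_eq_fract q.toNat q p r (p' - k * p) hq
    (by rw [Int.toNat_of_nonneg hq.le]) hr0 hrq.le
    (by
      rw [show p * r - (p' - k * p) * q = -σ by rw [← hdet, hqk]; ring, abs_neg]
      rcases hσ with rfl | rfl <;> rfl) x hx hx0 hx1 α hα2 (by
      have h1 : (p' - q' * x) / (q * x - p) * (q * x - p) = p' - q' * x := div_mul_cancel₀ _ hne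
      rw [hα]
      push_cast
      linear_combination h1 - x * hqkR)
  have hfr : Int.fract α = (p' - q' * x) / (q * x - p) - z := by
    have := cfCylinder_subset_Ioo l hl
    exact Int.fract_eq_iff.2 ⟨this.1.le, this.2, k + z, by rw [hα]; push_cast; ring⟩
  refine ⟨n + 1, fun i hi => ?_⟩
  rw [cfCoeff, Nat.add_sub_cancel, add_comm, Function.iterate_add_apply, hn, hfr]
  exact floor_iterate_gaussMap_of_mem_cfCylinder l _ hl i hi

/-! ### Coding of the Cantor set -/

/-- The ternary digit `0` or `2` attached to a bit. -/
def cantorDigit (b : Bool) : ℝ := if b then 2 else 0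

/-- The point of the Cantor set coded by a binary sequence. -/
noncomputable def cantorPoint (a : ℕ → Bool) : ℝ := ∑' i, cantorDigit (a i) / 3 ^ (i + 1)

/-- The ternary truncation of the point coded by `a`. -/
noncomputable def cantorTrunc (n : ℕ) (a : ℕ → Bool) : ℝ :=
  ∑ i ∈ Finset.range n, cantorDigit (a i) / 3 ^ (i + 1)

/-- Follow `a` for `n` digits and `b` afterwards. -/
def concat (n : ℕ) (a b : ℕ → Bool) : ℕ → Bool := fun i => if i < n then a i else b (i - n)

theorem cantorDigit_nonneg (b : Bool) : 0 ≤ cantorDigit b := by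
  cases b <;> simp [cantorDigit]

theorem cantorDigit_le_two (b : Bool) : cantorDigit b ≤ 2 := by
  cases b <;> simp [cantorDigit]

theorem hasSum_two_div_three_pow : HasSum (fun i : ℕ => (2 : ℝ) / 3 ^ (i + 1)) 1 := by
  have h := (hasSum_geometric_of_lt_one (r := (3 : ℝ)⁻¹) (by norm_num) (by norm_num)).mul_left (2 / 3)
  have h1 : (fun i : ℕ => (2 : ℝ) / 3 ^ (i + 1)) = fun i => 2 / 3 * (3 : ℝ)⁻¹ ^ i := by
    ext i; rw [pow_succ, inv_pow]; field_simp
  rw [h1]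
  rwa [show (2 / 3 * (1 - 3⁻¹)⁻¹ : ℝ) = 1 by norm_num] at h

theorem summable_cantorPoint (a : ℕ → Bool) :
    Summable fun i => cantorDigit (a i) / 3 ^ (i + 1) :=
  hasSum_two_div_three_pow.summable.of_nonneg_of_le
    (fun i => div_nonneg (cantorDigit_nonneg _) (by positivity))
    fun i => by gcongr; exact cantorDigit_le_two _

theorem cantorPoint_nonneg (a : ℕ → Bool) : 0 ≤ cantorPoint a :=
  tsum_nonneg fun i => div_nonneg (cantorDigit_nonneg _) (by positivity)

theorem cantorPoint_le_one (a : ℕ → Bool) : cantorPoint a ≤ 1 := by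
  rw [← hasSum_two_div_three_pow.tsum_eq]
  exact (summable_cantorPoint a).tsum_le_tsum (fun i => by gcongr; exact cantorDigit_le_two _)
    hasSum_two_div_three_pow.summable

theorem cantorPoint_not (a : ℕ → Bool) : cantorPoint (fun i => !a i) = 1 - cantorPoint a := by
  rw [eq_sub_iff_add_eq, cantorPoint, cantorPoint,
    ← (summable_cantorPoint _).tsum_add (summable_cantorPoint a),
    ← hasSum_two_div_three_pow.tsum_eq]
  congr 1
  ext i
  cases a i <;> simp [cantorDigit]

theorem cantorPoint_eq_trunc_add (n : ℕ) (a : ℕ → Bool) :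
    cantorPoint a = cantorTrunc n a + cantorPoint (fun i => a (i + n)) / 3 ^ n := by
  rw [cantorPoint, ← (summable_cantorPoint a).sum_add_tsum_nat_add n, cantorPoint, cantorTrunc,
    ← tsum_div_const]
  congr 2
  ext i
  rw [div_div, ← pow_add]
  ring_nf

theorem cantorTrunc_congr {n : ℕ} {a b : ℕ → Bool} (h : ∀ i < n, a i = b i) :
    cantorTrunc n a = cantorTrunc n b :=
  Finset.sum_congr rfl fun i hi => by rw [h i (Finset.mem_range.1 hi)]

theorem cantorPoint_concat (n : ℕ) (a b : ℕ → Bool) :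
    cantorPoint (concat n a b) = cantorTrunc n a + cantorPoint b / 3 ^ n := by
  rw [cantorPoint_eq_trunc_add n, cantorTrunc_congr (b := a) fun i hi => by simp [concat, hi]]
  simp [concat]

theorem two_thirds_le_cantorPoint {a : ℕ → Bool} (h : a 0 = true) : 2 / 3 ≤ cantorPoint a := by
  rw [cantorPoint_eq_trunc_add 1]
  have := cantorPoint_nonneg (fun i => a (i + 1))
  simp only [cantorTrunc, Finset.sum_range_one, h, cantorDigit, if_true]
  norm_num
  linarith

theorem cantorPoint_le_one_third {a : ℕ → Bool} (h : a 0 = false) : cantorPoint a ≤ 1 / 3 := by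
  rw [cantorPoint_eq_trunc_add 1]
  have := cantorPoint_le_one (fun i => a (i + 1))
  simp only [cantorTrunc, Finset.sum_range_one, h, cantorDigit]
  norm_num
  linarith

theorem cantorPoint_injective : Function.Injective cantorPoint := by
  intro a b hab
  by_contra hne
  have hex : ∃ i, a i ≠ b i := Function.ne_iff.1 hne
  classical
  have hi := Nat.find_spec hex
  have hlt : ∀ j < Nat.find hex, a j = b j := fun j hj => not_not.1 (Nat.find_min hex hj)
  set i := Nat.find hex
  rw [cantorPoint_eq_trunc_add i a, cantorPoint_eq_trunc_add i b, cantorTrunc_congr hlt,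
    add_right_inj, div_left_inj' (by positivity)] at hab
  have key : ∀ c d : ℕ → Bool, c 0 = true → d 0 = false → cantorPoint c ≠ cantorPoint d := by
    intro c d hc hd h
    have := two_thirds_le_cantorPoint hc
    have := cantorPoint_le_one_third hd
    linarith
  cases ha : a i <;> cases hb : b i
  · exact hi (ha.trans hb.symm)
  · exact key _ _ (by simpa using hb) (by simpa using ha) hab.symm
  · exact key _ _ (by simpa using ha) (by simpa using hb) hab
  · exact hi (ha.trans hb.symm)

theorem middleThirdCantorSet_eq_range : middleThirdCantorSet = Set.range cantorPoint := by
  ext x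
  constructor
  · rintro ⟨-, a, ha, rfl⟩
    refine ⟨fun i => decide (a i = 2), ?_⟩
    unfold cantorPoint
    congr 1
    ext i
    rcases ha i with h | h <;> simp [h, cantorDigit]
  · rintro ⟨a, rfl⟩
    refine ⟨⟨cantorPoint_nonneg a, cantorPoint_le_one a⟩, fun i => if a i then 2 else 0, fun i => ?_, ?_⟩
    · cases a i <;> simp
    · unfold cantorPoint
      congr 1
      ext i
      cases h : a i <;> simp [h, cantorDigit]

/-- Ternary fractions with digits `0` and `2` are points of the Cantor set. -/
theorem exists_cantorPoint_eq_sum (M : ℕ) (F : Finset ℕ) (hF : F ⊆ Finset.range M) :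
    ∃ b, cantorPoint b = (∑ j ∈ F, 2 * (3 : ℝ) ^ j) / 3 ^ M := by
  classical
  refine ⟨fun i => decide (i < M ∧ M - 1 - i ∈ F), ?_⟩
  rw [cantorPoint, tsum_eq_sum (s := Finset.range M)]
  · rw [← Finset.sum_range_reflect, ← Finset.inter_eq_right.2 hF, ← Finset.filter_mem_eq_inter,
      Finset.sum_filter, Finset.sum_div]
    refine Finset.sum_congr rfl fun j hj => ?_
    have hj' := Finset.mem_range.1 hj
    have h1 : M - 1 - j < M := by omega
    have h2 : M - 1 - (M - 1 - j) = j := by omega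
    have h3 : M - 1 - j + 1 = M - j := by omega
    rw [h2, h3]
    by_cases hjF : j ∈ F
    · have h4 : j ∈ Finset.filter (· ∈ F) (Finset.range M) := Finset.mem_filter.2 ⟨hj, hjF⟩
      rw [if_pos hjF, decide_eq_true ⟨h1, h4⟩,
        cantorDigit, if_pos rfl]
      rw [div_eq_div_iff (by positivity) (by positivity), mul_assoc, ← pow_add,
        Nat.add_sub_cancel' hj'.le]
    · simp [h1, hjF, cantorDigit]
  · intro i hi
    have : ¬ i < M := by simpa using hi
    simp [this, cantorDigit]

theorem exists_cantorPoint_irrational {m y₀ : ℝ} (hm : m ≠ 0) (hy : y₀ ≤ 1 / 2) :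
    ∃ a : ℕ → Bool, a 0 = true ∧ Irrational (m / (cantorPoint a - y₀) ^ 2) := by
  by_contra! h
  let f : (ℕ → Bool) → ℝ := fun a => cantorPoint (fun i => Nat.casesOn i true a)
  have hf0 : ∀ a, 0 < f a - y₀ := fun a => by
    have := two_thirds_le_cantorPoint (a := fun i => Nat.casesOn i true a) rfl
    show 0 < cantorPoint _ - _
    linarith
  have hf : Function.Injective f := by
    intro a b hab
    have := cantorPoint_injective hab
    funext i
    have h1 := congrFun this (i + 1)
    exact h1
  have hq : ∀ a, ∃ q : ℚ, (q : ℝ) = m / (f a - y₀) ^ 2 := fun a => by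
    have := h (fun i => Nat.casesOn i true a) rfl
    simpa [Irrational] using this
  choose q hq using hq
  have hinj : Function.Injective q := by
    intro a b hab
    apply hf
    have h1 : m / (f a - y₀) ^ 2 = m / (f b - y₀) ^ 2 := by rw [← hq, ← hq, hab]
    rw [div_eq_div_iff (pow_pos (hf0 a) 2).ne' (pow_pos (hf0 b) 2).ne'] at h1
    have h2 := mul_left_cancel₀ hm h1
    have := (pow_left_inj₀ (hf0 b).le (hf0 a).le two_ne_zero).1 h2
    linarith
  have hcount : Countable (ℕ → Bool) := hinj.countable
  classical
  obtain ⟨g, hg⟩ := exists_injective_nat (ℕ → Bool)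
  exact Function.cantor_injective (fun s : Set ℕ => g fun i => decide (i ∈ s))
    (fun s t hst => Set.ext fun i => by simpa using congrFun (hg hst) i)

/-! ### Dense subset sums -/

theorem exists_pair_close {t : ℝ} (ht : Irrational t) {ℓ : ℝ} (hℓ : 0 < ℓ) (n₀ : ℕ) :
    ∃ a b : ℕ, n₀ ≤ a ∧ n₀ ≤ b ∧ a ≠ b ∧ ∃ z : ℤ,
      ℓ / 3 ≤ 2 * 3 ^ b * t - 2 * 3 ^ a * t - z ∧ 2 * 3 ^ b * t - 2 * 3 ^ a * t - z < ℓ := by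
  let T : ℕ → ℝ := fun j => 2 * 3 ^ j * t
  have h1 : ∃ a b : ℕ, n₀ ≤ a ∧ a < b ∧ |Int.fract (T b) - Int.fract (T a)| < ℓ / 3 := by
    obtain ⟨c, -, φ, hφ, hlim⟩ := (isCompact_Icc (a := (0 : ℝ)) (b := 1)).tendsto_subseq
      (x := fun j => Int.fract (T j)) fun j => ⟨Int.fract_nonneg _, (Int.fract_lt_one _).le⟩
    obtain ⟨N, hN⟩ := Metric.cauchySeq_iff.1 hlim.cauchySeq (ℓ / 3) (by positivity)
    refine ⟨φ (max N n₀), φ (max N n₀ + 1), (le_max_right _ _).trans hφ.le_apply,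
      hφ (Nat.lt_succ_self _), ?_⟩
    have := hN (max N n₀ + 1) (by omega) (max N n₀) (by omega)
    rwa [Real.dist_eq] at this
  obtain ⟨a, b, ha, hab, h⟩ := h1
  set d := Int.fract (T b) - Int.fract (T a) with hd
  have hdz : d = T b - T a - (⌊T b⌋ - ⌊T a⌋ : ℤ) := by
    rw [hd, Int.fract, Int.fract]; push_cast; ring
  have hd0 : d ≠ 0 := by
    intro h0
    rw [hdz] at h0
    have h_int : ((2 * 3 ^ b - 2 * 3 ^ a : ℤ) : ℝ) * t = (⌊T b⌋ - ⌊T a⌋ : ℤ) := by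
      push_cast at h0 ⊢
      simp only [T] at h0 ⊢
      linarith
    have hne : (2 * 3 ^ b - 2 * 3 ^ a : ℤ) ≠ 0 := by
      have : (3 : ℤ) ^ a < 3 ^ b := pow_lt_pow_right₀ (by norm_num) hab
      omega
    exact (ht.intCast_mul hne).ne_int _ h_int
  have hpos := abs_pos.2 hd0
  obtain ⟨i, hi1, hi2⟩ : ∃ i : ℕ, ℓ / 3 ≤ 3 ^ i * |d| ∧ 3 ^ i * |d| < ℓ := by
    have hex : ∃ i : ℕ, ℓ / 3 ≤ 3 ^ i * |d| := by
      obtain ⟨i, hi⟩ := pow_unbounded_of_one_lt (ℓ / 3 / |d|) (by norm_num : (1 : ℝ) < 3)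
      exact ⟨i, by rw [div_lt_iff₀ hpos] at hi; exact hi.le⟩
    classical
    refine ⟨Nat.find hex, Nat.find_spec hex, ?_⟩
    cases hk : Nat.find hex with
    | zero => simp; linarith
    | succ k =>
      have := Nat.find_min hex (m := k) (by omega)
      rw [pow_succ]
      linarith
  have hT : ∀ j, T (j + i) = 3 ^ i * T j := fun j => by simp only [T, pow_add]; ring
  have hT' : ∀ j, 2 * 3 ^ j * t = T j := fun j => rfl
  rcases hd0.lt_or_gt with hneg | hpos
  · refine ⟨b + i, a + i, by omega, by omega, by omega, -3 ^ i * (⌊T b⌋ - ⌊T a⌋), ?_⟩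
    rw [hT', hT', hT, hT]
    rw [abs_of_neg hneg, hdz] at hi1 hi2
    push_cast at hi1 hi2 ⊢
    constructor <;> linarith
  · refine ⟨a + i, b + i, by omega, by omega, by omega, 3 ^ i * (⌊T b⌋ - ⌊T a⌋), ?_⟩
    rw [hT', hT', hT, hT]
    rw [abs_of_pos hpos, hdz] at hi1 hi2
    push_cast at hi1 hi2 ⊢
    constructor <;> linarith

theorem exists_chain_of_subset_sums {t : ℝ} (ht : Irrational t) {ℓ : ℝ} (hℓ : 0 < ℓ) (K : ℕ) :
    ∃ (M : ℕ) (β : ℝ) (u : ℕ → ℝ), u 0 = 0 ∧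
      (∀ k < K, ℓ / 3 ≤ u (k + 1) - u k ∧ u (k + 1) - u k < ℓ) ∧
      ∀ k ≤ K, ∃ F ⊆ Finset.range M, ∃ z : ℤ, ∑ j ∈ F, 2 * 3 ^ j * t = β + u k + z := by
  induction K with
  | zero =>
    refine ⟨0, 0, fun _ => 0, rfl, by simp, fun k _ => ⟨∅, by simp, 0, by simp⟩⟩
  | succ K ih =>
    obtain ⟨M, β, u, hu0, hu, hF⟩ := ih
    obtain ⟨a, b, ha, hb, -, z, hz1, hz2⟩ := exists_pair_close ht hℓ M
    set e := 2 * 3 ^ b * t - 2 * 3 ^ a * t - z with he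
    refine ⟨max a b + 1, β + 2 * 3 ^ a * t, fun k => if k ≤ K then u k else u K + e, by simp [hu0],
      fun k hk => ?_, fun k hk => ?_⟩
    · rcases Nat.lt_succ_iff_lt_or_eq.1 hk with h | rfl
      · simpa [h.le, Nat.succ_le_of_lt h] using hu k h
      · simp [hz1, hz2]
    · rcases Nat.le_succ_iff.1 hk with h | rfl
      · obtain ⟨F, hFM, y, hy⟩ := hF k h
        refine ⟨insert a F, ?_, y, ?_⟩
        · intro i hi
          rcases Finset.mem_insert.1 hi with rfl | hi
          · simp
          · have := Finset.mem_range.1 (hFM hi)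
            exact Finset.mem_range.2 (by omega)
        · rw [Finset.sum_insert fun h => by have := Finset.mem_range.1 (hFM h); omega, hy]
          simp only [h, if_true]
          ring
      · obtain ⟨F, hFM, y, hy⟩ := hF K le_rfl
        refine ⟨insert b F, ?_, y + z, ?_⟩
        · intro i hi
          rcases Finset.mem_insert.1 hi with rfl | hi
          · simp
          · have := Finset.mem_range.1 (hFM hi)
            exact Finset.mem_range.2 (by omega)
        · rw [Finset.sum_insert fun h => by have := Finset.mem_range.1 (hFM h); omega, hy]
          simp only [show ¬ K + 1 ≤ K by omega, if_false, he]
          push_cast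
          ring

theorem exists_subset_sum_close {t : ℝ} (ht : Irrational t) {ℓ : ℝ} (hℓ : 0 < ℓ) :
    ∃ M : ℕ, ∀ θ : ℝ, ∃ F ⊆ Finset.range M, ∃ z : ℤ, |θ + ∑ j ∈ F, 2 * 3 ^ j * t - z| < ℓ := by
  obtain ⟨K, hK⟩ := exists_nat_gt (3 / ℓ)
  obtain ⟨M, β, u, hu0, hu, hF⟩ := exists_chain_of_subset_sums ht hℓ K
  refine ⟨M, fun θ => ?_⟩
  have hgrow : ∀ k ≤ K, k * (ℓ / 3) ≤ u k := by
    intro k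
    induction k with
    | zero => simp [hu0]
    | succ k ih =>
      intro hk
      have h1 := ih (by omega)
      have h2 := (hu k (by omega)).1
      push_cast
      linarith
  have hbig : 1 < u K := by
    have := hgrow K le_rfl
    rw [div_lt_iff₀ hℓ] at hK
    linarith
  set N := ⌈θ + β⌉ with hN
  have hN1 : θ + β ≤ N := Int.le_ceil _
  have hN2 : (N : ℝ) < θ + β + 1 := Int.ceil_lt_add_one _
  have hex : ∃ k, (N : ℝ) < θ + β + u k := ⟨K, by linarith⟩
  classical
  have hspec := Nat.find_spec hex
  have hle : Nat.find hex ≤ K := Nat.find_min' hex (by linarith)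
  cases hk : Nat.find hex with
  | zero => rw [hk, hu0] at hspec; linarith
  | succ k =>
    have hmin := Nat.find_min hex (m := k) (by omega)
    rw [hk] at hspec hle
    obtain ⟨F, hFM, z, hz⟩ := hF k (by omega)
    refine ⟨F, hFM, N + z, ?_⟩
    have := (hu k (by omega)).2
    rw [hz, abs_lt]
    push_cast
    constructor <;> linarith

/-! ### Hitting a prescribed set modulo one by an inversion of the Cantor set -/

theorem exists_cantorPoint_div_mem_of_le {J : Set ℝ} (hJ : IsOpen J) (hJne : J.Nonempty) :
    ∃ L₀ : ℝ, ∀ L ≥ L₀, ∀ y₀ : ℝ, -10 ≤ y₀ → y₀ ≤ 1 / 2 → ∀ κ : ℝ,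
      ∃ a : ℕ → Bool, 1 / 6 ≤ cantorPoint a - y₀ ∧
        ∃ z : ℤ, L / (cantorPoint a - y₀) + κ - z ∈ J := by
  obtain ⟨c, hc⟩ := hJne
  obtain ⟨ρ, hρ, hball⟩ := Metric.isOpen_iff.1 hJ c hc
  by_contra! hcon
  choose L hL y hy1 hy2 κ hbad using fun k : ℕ => hcon (k + 1)
  have hL1 : ∀ k, 1 ≤ L k := fun k => by
    have := hL k; have : (0 : ℝ) ≤ k := k.cast_nonneg; linarith
  choose n hn1 hn2 using fun k => exists_nat_pow_near (hL1 k) (by norm_num : (1 : ℝ) < 3)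
  set m : ℕ → ℝ := fun k => L k / 3 ^ n k with hm
  have hm1 : ∀ k, 1 ≤ m k := fun k => (one_le_div (by positivity)).2 (hn1 k)
  have hm2 : ∀ k, m k ≤ 3 := fun k => by
    rw [hm]; dsimp only; rw [div_le_iff₀ (by positivity)]; have := hn2 k; rw [pow_succ] at this; linarith
  obtain ⟨⟨m', y'⟩, hmem, φ, hφ, hlim⟩ := ((isCompact_Icc (a := (1 : ℝ)) (b := 3)).prod
    (isCompact_Icc (a := (-10 : ℝ)) (b := 1 / 2))).tendsto_subseq (x := fun k => (m k, y k))
      fun k => ⟨⟨hm1 k, hm2 k⟩, hy1 k, hy2 k⟩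
  have hm'1 : 1 ≤ m' := hmem.1.1
  have hy'2 : y' ≤ 1 / 2 := hmem.2.2
  obtain ⟨a, ha0, hirr⟩ := exists_cantorPoint_irrational (m := m') (by linarith) hy'2
  have ha23 := two_thirds_le_cantorPoint ha0
  obtain ⟨M, hM⟩ := exists_subset_sum_close hirr.neg (half_pos hρ)
  set lam := m' / (cantorPoint a - y') ^ 2 with hlam
  let f : ℝ × ℝ × ℝ × ℝ → ℝ := fun w => w.1 / ((w.2.2.1 - w.2.1) * (w.2.2.2 - w.2.1))
  have hf : ContinuousAt f (m', y', cantorPoint a, cantorPoint a) := by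
    refine ContinuousAt.div (by fun_prop) (by fun_prop) ?_
    have : 0 < cantorPoint a - y' := by linarith
    exact (mul_pos this this).ne'
  have hfval : f (m', y', cantorPoint a, cantorPoint a) = lam := by
    simp only [f, hlam]; rw [sq]
  obtain ⟨ε, hε, hfε⟩ := Metric.continuousAt_iff.1 hf (ρ / 2 / 3 ^ M) (by positivity)
  rw [hfval] at hfε
  have hntop : Filter.Tendsto (fun k => n (φ k)) Filter.atTop Filter.atTop := by
    have h1 : Filter.Tendsto n Filter.atTop Filter.atTop := by
      refine Filter.tendsto_atTop.2 fun N => Filter.eventually_atTop.2 ⟨3 ^ N, fun k hk => ?_⟩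
      by_contra! h
      have h2 : (3 : ℝ) ^ (n k + 1) ≤ 3 ^ N := pow_le_pow_right₀ (by norm_num) h
      have h3 : (3 : ℝ) ^ N ≤ k := by exact_mod_cast hk
      linarith [hL k, hn2 k]
    exact h1.comp hφ.tendsto_atTop
  have hsmall : Filter.Tendsto (fun k => (1 / 3 : ℝ) ^ (n (φ k) - M)) Filter.atTop (nhds 0) :=
    (tendsto_pow_atTop_nhds_zero_of_lt_one (by norm_num) (by norm_num)).comp
      ((Filter.tendsto_sub_atTop_nat M).comp hntop)
  obtain ⟨k, hk1, hk2, hk3⟩ := ((Metric.tendsto_nhds.1 hlim ε hε).and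
    ((hsmall.eventually_lt_const hε).and (hntop.eventually_ge_atTop (M + 1)))).exists
  set j := φ k
  obtain ⟨p, hp⟩ : ∃ p, n j = p + 1 + M := ⟨n j - M - 1, by omega⟩
  have hp' : n j - M = p + 1 := by omega
  set u := cantorTrunc (p + 1) a with hu
  have h23 : ∀ b, concat (p + 1) a b 0 = true := fun b => by simp [concat, ha0]
  have hdist : ∀ b, |cantorPoint (concat (p + 1) a b) - cantorPoint a| < ε := by
    intro b
    rw [cantorPoint_concat, cantorPoint_eq_trunc_add (p + 1) a, add_sub_add_left_eq_sub, ← sub_div,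
      abs_div, abs_of_pos (by positivity : (0 : ℝ) < 3 ^ (p + 1))]
    rw [hp', one_div, inv_pow] at hk2
    refine lt_of_le_of_lt ?_ hk2
    rw [div_eq_mul_inv]
    refine mul_le_of_le_one_left (by positivity) ?_
    rw [abs_le]
    constructor <;> linarith [cantorPoint_nonneg b, cantorPoint_le_one b,
      cantorPoint_nonneg fun i => a (i + (p + 1)), cantorPoint_le_one fun i => a (i + (p + 1))]
  have hu0 : cantorPoint (concat (p + 1) a fun _ => false) = u := by
    rw [cantorPoint_concat]; simp [cantorPoint, cantorDigit, hu]
  obtain ⟨F, hF, z, hz⟩ := hM (L j / (u - y j) + κ j - c)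
  obtain ⟨b, hb⟩ := exists_cantorPoint_eq_sum M F hF
  set S := ∑ i ∈ F, 2 * (3 : ℝ) ^ i with hS
  set v := cantorPoint (concat (p + 1) a b) with hv
  have hv' : v = u + S / 3 ^ n j := by
    rw [hv, cantorPoint_concat, hb, hp, div_div, ← pow_add, add_comm M]
  have hv23 : 2 / 3 ≤ v := two_thirds_le_cantorPoint (h23 b)
  have hu23 : 2 / 3 ≤ u := hu0 ▸ two_thirds_le_cantorPoint (h23 _)
  have hyj := hy2 j
  refine hbad j (concat (p + 1) a b) (by linarith) z (hball ?_)
  have hS0 : 0 ≤ S := Finset.sum_nonneg fun i _ => by positivity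
  have hS1 : S ≤ 3 ^ M := by
    have := cantorPoint_le_one b
    rwa [hb, div_le_one (by positivity)] at this
  have hdiff : L j / (v - y j) = L j / (u - y j) - S * f (m j, y j, u, v) := by
    simp only [f, hm]
    have h1 : u - y j ≠ 0 := by linarith
    have h2 : v - y j ≠ 0 := by linarith
    field_simp
    rw [hv']
    field_simp
    ring
  have hfclose : |f (m j, y j, u, v) - lam| < ρ / 2 / 3 ^ M := by
    rw [← Real.dist_eq]
    apply hfε
    have h1 := hdist b
    have h2 := hdist fun _ => false
    rw [hu0] at h2
    have h3 := hk1
    simp only [Function.comp_apply, Prod.dist_eq, max_lt_iff] at h3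
    simp only [Prod.dist_eq, max_lt_iff]
    exact ⟨h3.1, h3.2, by rwa [Real.dist_eq], by rwa [Real.dist_eq]⟩
  have herr : |S * (f (m j, y j, u, v) - lam)| ≤ ρ / 2 := by
    rw [abs_mul, abs_of_nonneg hS0]
    calc _ ≤ 3 ^ M * (ρ / 2 / 3 ^ M) := by gcongr
      _ = _ := by field_simp
  have hsum : ∑ i ∈ F, 2 * 3 ^ i * -lam = -(S * lam) := by
    rw [← Finset.sum_mul, ← hS]; ring
  rw [hsum] at hz
  rw [Metric.mem_ball, Real.dist_eq, hdiff]
  rw [abs_lt] at hz ⊢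
  rw [abs_le] at herr
  constructor <;> linarith

theorem exists_cantorPoint_div_mem {J : Set ℝ} (hJ : IsOpen J) (hJne : J.Nonempty) :
    ∃ L₀ : ℝ, ∀ L ≥ L₀, ∀ y₀ : ℝ, |y₀| ≤ 10 → ∀ κ : ℤ → ℝ,
      ∃ σ : ℤ, (σ = 1 ∨ σ = -1) ∧ ∃ a : ℕ → Bool, 1 / 6 ≤ σ * (cantorPoint a - y₀) ∧
        ∃ z : ℤ, σ * L / (cantorPoint a - y₀) + κ σ - z ∈ J := by
  obtain ⟨L₀, h⟩ := exists_cantorPoint_div_mem_of_le hJ hJne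
  refine ⟨L₀, fun L hL y₀ hy κ => ?_⟩
  rw [abs_le] at hy
  rcases le_total y₀ (1 / 2) with hle | hge
  · obtain ⟨a, ha, z, hz⟩ := h L hL y₀ hy.1 hle (κ 1)
    exact ⟨1, Or.inl rfl, a, by simpa using ha, z, by simpa using hz⟩
  · obtain ⟨a, ha, z, hz⟩ := h L hL (1 - y₀) (by linarith) (by linarith) (κ (-1))
    refine ⟨-1, Or.inr rfl, fun i => !a i, ?_, z, ?_⟩
    · rw [cantorPoint_not]; push_cast; linarith
    · rw [cantorPoint_not]
      convert hz using 3
      push_cast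
      rw [show 1 - cantorPoint a - y₀ = -(cantorPoint a - (1 - y₀)) by ring, div_neg, neg_one_mul,
        neg_div, neg_neg]

/-! ### Lattices in the plane -/

/-- The group of unimodular real matrices. -/
abbrev SL2R := Matrix.SpecialLinearGroup (Fin 2) ℝ

/-- The group of unimodular integer matrices. -/
abbrev SL2Z := Matrix.SpecialLinearGroup (Fin 2) ℤ

instance : FirstCountableTopology SL2R :=
  inferInstanceAs (FirstCountableTopology {A : Fin 2 → Fin 2 → ℝ // Matrix.det (Matrix.of A) = 1})

/-- The inclusion of integer matrices into real matrices. -/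
def intMat : SL2Z →* SL2R := Matrix.SpecialLinearGroup.map (Int.castRingHom ℝ)

/-- The coordinates of the image of an integer vector. -/
def lat (A : SL2R) (i : Fin 2) (p q : ℤ) : ℝ := A i 0 * p + A i 1 * q

/-- Unimodular matrices whose lattice has no nonzero vector of squared length less than `e`. -/
def thick (e : ℝ) : Set SL2R :=
  {A | ∀ p q : ℤ, (p ≠ 0 ∨ q ≠ 0) → e ≤ lat A 0 p q ^ 2 + lat A 1 p q ^ 2}

/-- Upper triangular unipotent matrices. -/
def unip (s : ℝ) : SL2R := ⟨!![1, s; 0, 1], by simp [Matrix.det_fin_two]⟩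

/-- The diagonal matrix expanding the horizontal direction by `√3`. -/
noncomputable def diag3 : SL2R :=
  ⟨!![√3, 0; 0, (√3)⁻¹], by simp [Matrix.det_fin_two]⟩

theorem SL2R_det (A : SL2R) : A 0 0 * A 1 1 - A 0 1 * A 1 0 = 1 := by
  have := A.det_coe
  rwa [Matrix.det_fin_two] at this

theorem SL2Z_det (A : SL2Z) : A 0 0 * A 1 1 - A 0 1 * A 1 0 = 1 := by
  have := A.det_coe
  rwa [Matrix.det_fin_two] at this

theorem SL2R_mul_apply (A B : SL2R) (i j : Fin 2) :
    (A * B) i j = A i 0 * B 0 j + A i 1 * B 1 j := by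
  simp [Matrix.mul_apply, Fin.sum_univ_two]

theorem intMat_apply (γ : SL2Z) (i j : Fin 2) : intMat γ i j = (γ i j : ℝ) := rfl

theorem continuous_SL2R_apply (i j : Fin 2) : Continuous fun A : SL2R => A i j :=
  (continuous_apply_apply i j).comp continuous_subtype_val

theorem continuous_lat (i : Fin 2) (p q : ℤ) : Continuous fun A => lat A i p q :=
  ((continuous_SL2R_apply i 0).mul continuous_const).add
    ((continuous_SL2R_apply i 1).mul continuous_const)

theorem continuous_unip : Continuous unip := by
  refine Continuous.subtype_mk (continuous_pi fun i => continuous_pi fun j => ?_) _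
  fin_cases i <;> fin_cases j <;> simp <;> fun_prop

theorem unip_apply (s : ℝ) :
    unip s 0 0 = 1 ∧ unip s 0 1 = s ∧ unip s 1 0 = 0 ∧ unip s 1 1 = 1 :=
  ⟨rfl, rfl, rfl, rfl⟩

theorem diag3_apply :
    diag3 0 0 = √3 ∧ diag3 0 1 = 0 ∧ diag3 1 0 = 0 ∧ diag3 1 1 = (√3)⁻¹ :=
  ⟨rfl, rfl, rfl, rfl⟩

theorem unip_zero : unip 0 = 1 := by
  ext i j; fin_cases i <;> fin_cases j <;> simp [unip]

theorem unip_mul_unip (s t : ℝ) : unip s * unip t = unip (s + t) := by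
  ext i j
  rw [SL2R_mul_apply]
  fin_cases i <;> fin_cases j <;> simp [unip_apply, add_comm]

theorem diag3_mul_unip (s : ℝ) : diag3 * unip s = unip (3 * s) * diag3 := by
  have h : √3 * √3 = 3 := Real.mul_self_sqrt (by norm_num)
  have h1 : √3 * s = 3 * s * (√3)⁻¹ := by
    field_simp; linear_combination s * h
  ext i j
  rw [SL2R_mul_apply, SL2R_mul_apply]
  fin_cases i <;> fin_cases j <;> simp [unip_apply, diag3_apply, h1]

theorem lat_mul_intMat (A : SL2R) (γ : SL2Z) (i : Fin 2) (p q : ℤ) :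
    lat (A * intMat γ) i p q = lat A i (γ 0 0 * p + γ 0 1 * q) (γ 1 0 * p + γ 1 1 * q) := by
  simp only [lat, SL2R_mul_apply, intMat_apply]
  push_cast
  ring

theorem lat_unip_zero (s : ℝ) (A : SL2R) (p q : ℤ) :
    lat (unip s * A) 0 p q = lat A 0 p q + s * lat A 1 p q := by
  simp only [lat, SL2R_mul_apply, unip_apply]; ring

theorem lat_unip_one (s : ℝ) (A : SL2R) (p q : ℤ) :
    lat (unip s * A) 1 p q = lat A 1 p q := by
  simp only [lat, SL2R_mul_apply, unip_apply]; ring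

theorem lat_diag3_zero (A : SL2R) (p q : ℤ) : lat (diag3 * A) 0 p q = √3 * lat A 0 p q := by
  simp only [lat, SL2R_mul_apply, diag3_apply]; ring

theorem lat_diag3_one (A : SL2R) (p q : ℤ) : lat (diag3 * A) 1 p q = (√3)⁻¹ * lat A 1 p q := by
  simp only [lat, SL2R_mul_apply, diag3_apply]; ring

theorem SL2Z_mulVec_ne_zero (γ : SL2Z) {p q : ℤ} (h : p ≠ 0 ∨ q ≠ 0) :
    γ 0 0 * p + γ 0 1 * q ≠ 0 ∨ γ 1 0 * p + γ 1 1 * q ≠ 0 := by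
  by_contra! h'
  have hd := SL2Z_det γ
  have hp : p = 0 := by linear_combination -p * hd + γ 1 1 * h'.1 - γ 0 1 * h'.2
  have hq : q = 0 := by linear_combination -q * hd - γ 1 0 * h'.1 + γ 0 0 * h'.2
  simp [hp, hq] at h

theorem mul_intMat_mem_thick {e : ℝ} {A : SL2R} (hA : A ∈ thick e) (γ : SL2Z) :
    A * intMat γ ∈ thick e := fun p q h => by
  rw [lat_mul_intMat, lat_mul_intMat]
  exact hA _ _ (SL2Z_mulVec_ne_zero γ h)

theorem isClosed_thick (e : ℝ) : IsClosed (thick e) := by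
  simp only [thick, Set.ofPred_forall]
  exact isClosed_iInter fun p => isClosed_iInter fun q => isClosed_iInter fun _ =>
    isClosed_le continuous_const (((continuous_lat 0 p q).pow 2).add ((continuous_lat 1 p q).pow 2))

/-- Unimodular matrices with entries bounded by `R`. -/
def boundedMat (R : ℝ) : Set SL2R := {A | ∀ i j, |A i j| ≤ R}

theorem isCompact_boundedMat (R : ℝ) : IsCompact (boundedMat R) := by
  have hcl : IsClosed {A : Matrix (Fin 2) (Fin 2) ℝ | A.det = 1} :=
    isClosed_eq (Continuous.matrix_det continuous_id) continuous_const
  have hemb : Topology.IsClosedEmbedding ((↑) : SL2R → Matrix (Fin 2) (Fin 2) ℝ) :=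
    hcl.isClosedEmbedding_subtypeVal
  have hK : IsCompact (Set.pi Set.univ fun _ : Fin 2 => Set.pi Set.univ fun _ : Fin 2 =>
      Set.Icc (-R) R) :=
    isCompact_univ_pi fun _ => isCompact_univ_pi fun _ => isCompact_Icc
  have h : boundedMat R = ((↑) : SL2R → Matrix (Fin 2) (Fin 2) ℝ) ⁻¹'
      Set.pi Set.univ fun _ => Set.pi Set.univ fun _ => Set.Icc (-R) R := by
    ext A
    exact ⟨fun h i _ j _ => abs_le.1 (h i j), fun h i j => abs_le.2 (h i trivial j trivial)⟩
  rw [h]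
  exact hemb.isCompact_preimage hK

theorem exists_mul_intMat_mem_boundedMat {e : ℝ} (he : 0 < e) {A : SL2R} (hA : A ∈ thick e) :
    ∃ γ : SL2Z, A * intMat γ ∈ boundedMat √(2 / e) := by
  let S : SL2Z → ℝ := fun γ => (A * intMat γ) 0 0 ^ 2 + (A * intMat γ) 1 0 ^ 2 +
    (A * intMat γ) 0 1 ^ 2 + (A * intMat γ) 1 1 ^ 2
  have hbdd : BddBelow (Set.range S) := ⟨0, by rintro _ ⟨γ, rfl⟩; positivity⟩
  obtain ⟨γ, hγ⟩ := exists_lt_of_ciInf_lt (lt_add_of_pos_right (iInf S) (by positivity : 0 < e / 4))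
  have hmin : ∀ η : SL2Z, S γ < S (γ * η) + e / 4 := fun η =>
    hγ.trans_le (by gcongr; exact ciInf_le hbdd _)
  refine ⟨γ, ?_⟩
  set B := A * intMat γ with hB
  have hBt : B ∈ thick e := mul_intMat_mem_thick hA γ
  have hS : ∀ η : SL2Z, S (γ * η) = (B * intMat η) 0 0 ^ 2 + (B * intMat η) 1 0 ^ 2 +
      (B * intMat η) 0 1 ^ 2 + (B * intMat η) 1 1 ^ 2 := fun η => by
    simp only [S, hB, map_mul, mul_assoc]
  have hup : ∀ k : ℤ, 0 < k ^ 2 * (B 0 0 ^ 2 + B 1 0 ^ 2) + 2 * k * (B 0 0 * B 0 1 + B 1 0 * B 1 1)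
      + e / 4 := fun k => by
    obtain ⟨η, h1, h2, h3, h4⟩ :
        ∃ η : SL2Z, η 0 0 = 1 ∧ η 0 1 = k ∧ η 1 0 = 0 ∧ η 1 1 = 1 :=
      ⟨⟨!![1, k; 0, 1], by simp [Matrix.det_fin_two]⟩, rfl, rfl, rfl, rfl⟩
    have h := hmin η
    rw [hS] at h
    simp only [SL2R_mul_apply B, intMat_apply, h1, h2, h3, h4] at h
    simp only [S, ← hB] at h
    push_cast at h
    linarith
  have hdn : ∀ k : ℤ, 0 < k ^ 2 * (B 0 1 ^ 2 + B 1 1 ^ 2) + 2 * k * (B 0 0 * B 0 1 + B 1 0 * B 1 1)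
      + e / 4 := fun k => by
    obtain ⟨η, h1, h2, h3, h4⟩ :
        ∃ η : SL2Z, η 0 0 = 1 ∧ η 0 1 = 0 ∧ η 1 0 = k ∧ η 1 1 = 1 :=
      ⟨⟨!![1, 0; k, 1], by simp [Matrix.det_fin_two]⟩, rfl, rfl, rfl, rfl⟩
    have h := hmin η
    rw [hS] at h
    simp only [SL2R_mul_apply B, intMat_apply, h1, h2, h3, h4] at h
    simp only [S, ← hB] at h
    push_cast at h
    linarith
  have hv := hBt 1 0 (by simp)
  have hw := hBt 0 1 (by simp)
  simp only [lat, Int.cast_one, Int.cast_zero, mul_one, mul_zero, add_zero, zero_add] at hv hw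
  have hu1 := hup 1
  have hu2 := hup (-1)
  have hd1 := hdn 1
  have hd2 := hdn (-1)
  push_cast at hu1 hu2 hd1 hd2
  have hdet := SL2R_det B
  set v := B 0 0 ^ 2 + B 1 0 ^ 2 with hvdef
  set w := B 0 1 ^ 2 + B 1 1 ^ 2 with hwdef
  set d := B 0 0 * B 0 1 + B 1 0 * B 1 1 with hddef
  have hvw : v * w = 1 + d ^ 2 := by
    rw [hvdef, hwdef, hddef]
    linear_combination (B 0 0 * B 1 1 - B 0 1 * B 1 0 + 1) * hdet
  have h1 : |2 * d| ≤ 5 / 4 * v := abs_le.2 ⟨by linarith, by linarith⟩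
  have h2 : |2 * d| ≤ 5 / 4 * w := abs_le.2 ⟨by linarith, by linarith⟩
  have h3 : 4 * d ^ 2 ≤ 25 / 16 * (v * w) := by
    have := mul_le_mul h1 h2 (abs_nonneg _) (by linarith)
    rw [abs_mul_abs_self] at this
    linarith
  have h4 : v * w ≤ 2 := by linarith
  have hv2 : v ≤ 2 / e := by
    rw [le_div_iff₀ he]; nlinarith
  have hw2 : w ≤ 2 / e := by
    rw [le_div_iff₀ he]; nlinarith
  intro i j
  apply Real.abs_le_sqrt
  have := sq_nonneg (B 0 0)
  have := sq_nonneg (B 0 1)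
  have := sq_nonneg (B 1 0)
  have := sq_nonneg (B 1 1)
  fin_cases i <;> fin_cases j <;> simp <;> linarith

/-! ### The walk driven by the Cantor digits -/

/-- One step of the walk. -/
noncomputable def walkStep (d : Bool) (A : SL2R) : SL2R := unip (-cantorDigit d) * diag3 * A

/-- The walk along a finite word. -/
noncomputable def walk : List Bool → SL2R → SL2R
  | [], A => A
  | d :: w, A => walk w (walkStep d A)

/-- The integer whose ternary digits, from the lowest one, are given by `b`. -/
def intSum (n : ℕ) (b : ℕ → Bool) : ℝ := ∑ i ∈ Finset.range n, cantorDigit (b i) * 3 ^ i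

/-- Replace the first `n` terms of `b` by those of `c`. -/
def splice (n : ℕ) (c b : ℕ → Bool) : ℕ → Bool := fun i => if i < n then c i else b i

/-- Points all of whose forward walks stay in `thick e`. -/
def thickFwd (e : ℝ) : Set SL2R := {A | ∀ w, walk w A ∈ thick e}

/-- The position `n` steps before `A` on the walk with past `b`. -/
noncomputable def back (n : ℕ) (b : ℕ → Bool) (A : SL2R) : SL2R :=
  diag3⁻¹ ^ n * unip (intSum n b) * A

/-- Points with a past, all of whose walks starting in the past stay in `thick e`. -/
def thickPast (e : ℝ) : Set ((ℕ → Bool) × SL2R) := {y | ∀ n, back n y.1 y.2 ∈ thickFwd e}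

theorem walkStep_mul (d : Bool) (A B : SL2R) : walkStep d (A * B) = walkStep d A * B := by
  simp only [walkStep, mul_assoc]

theorem walk_mul : ∀ (w : List Bool) (A B : SL2R), walk w (A * B) = walk w A * B
  | [], _, _ => rfl
  | d :: w, A, B => by rw [walk, walk, walkStep_mul, walk_mul w]

theorem continuous_walk : ∀ w : List Bool, Continuous (walk w)
  | [] => continuous_id
  | _ :: w => (continuous_walk w).comp (continuous_const.mul continuous_id)

theorem isClosed_thickFwd (e : ℝ) : IsClosed (thickFwd e) := by
  simp only [thickFwd, Set.ofPred_forall]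
  exact isClosed_iInter fun w => (isClosed_thick e).preimage (continuous_walk w)

theorem mul_intMat_mem_thickFwd {e : ℝ} {A : SL2R} (hA : A ∈ thickFwd e) (γ : SL2Z) :
    A * intMat γ ∈ thickFwd e := fun w => by
  rw [walk_mul]; exact mul_intMat_mem_thick (hA w) γ

theorem walkStep_mem_thickFwd {e : ℝ} {A : SL2R} (hA : A ∈ thickFwd e) (d : Bool) :
    walkStep d A ∈ thickFwd e := fun w => hA (d :: w)

theorem mem_thick_of_mem_thickFwd {e : ℝ} {A : SL2R} (hA : A ∈ thickFwd e) : A ∈ thick e := hA []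

theorem diag3_pow_mul_unip (n : ℕ) (s : ℝ) :
    diag3 ^ n * unip s = unip (3 ^ n * s) * diag3 ^ n := by
  induction n generalizing s with
  | zero => simp
  | succ n ih =>
    rw [pow_succ, mul_assoc, diag3_mul_unip, ← mul_assoc, ih, mul_assoc]
    congr 2
    ring

theorem diag3_inv_pow_mul_unip (n : ℕ) (s : ℝ) :
    diag3⁻¹ ^ n * unip (3 ^ n * s) = unip s * diag3⁻¹ ^ n := by
  rw [inv_pow, inv_mul_eq_iff_eq_mul, ← mul_assoc, diag3_pow_mul_unip, mul_inv_cancel_right]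

theorem walkStep_back_succ (n : ℕ) (b : ℕ → Bool) (A : SL2R) :
    walkStep (b n) (back (n + 1) b A) = back n b A := by
  have h : intSum (n + 1) b = 3 ^ n * cantorDigit (b n) + intSum n b := by
    rw [intSum, Finset.sum_range_succ, intSum]; ring
  rw [walkStep, back, back, h, ← unip_mul_unip, pow_succ']
  simp only [← mul_assoc]
  rw [mul_inv_cancel_right, mul_assoc (unip _) _ (unip _), diag3_inv_pow_mul_unip, ← mul_assoc,
    unip_mul_unip, neg_add_cancel, unip_zero, one_mul]

theorem back_mem_thickFwd_of_le {e : ℝ} {b : ℕ → Bool} {A : SL2R} {m n : ℕ} (hmn : m ≤ n)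
    (h : back n b A ∈ thickFwd e) : back m b A ∈ thickFwd e := by
  induction n, hmn using Nat.le_induction with
  | base => exact h
  | succ n _ ih => exact ih (walkStep_back_succ n b A ▸ walkStep_mem_thickFwd h (b n))

theorem continuous_intSum (n : ℕ) : Continuous (intSum n) :=
  continuous_finsetSum _ fun i _ =>
    ((continuous_of_discreteTopology (f := cantorDigit)).comp (continuous_apply i)).mul
      continuous_const

theorem isClosed_thickPast (e : ℝ) : IsClosed (thickPast e) := by
  simp only [thickPast, Set.ofPred_forall]
  refine isClosed_iInter fun n => (isClosed_thickFwd e).preimage ?_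
  exact (continuous_const.mul (continuous_unip.comp ((continuous_intSum n).comp continuous_fst))).mul
    continuous_snd

theorem intSum_congr {n : ℕ} {b c : ℕ → Bool} (h : ∀ i < n, b i = c i) :
    intSum n b = intSum n c :=
  Finset.sum_congr rfl fun i hi => by rw [h i (Finset.mem_range.1 hi)]

theorem intSum_splice {m n : ℕ} (h : n ≤ m) (b c : ℕ → Bool) :
    intSum m (splice n c b) = intSum m b - intSum n b + intSum n c := by
  have h1 : intSum m b = intSum n b + ∑ i ∈ Finset.Ico n m, cantorDigit (b i) * 3 ^ i := by
    rw [intSum, intSum, Finset.sum_range_add_sum_Ico _ h]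
  have h2 : intSum m (splice n c b) = intSum n c +
      ∑ i ∈ Finset.Ico n m, cantorDigit (b i) * 3 ^ i := by
    rw [intSum, ← Finset.sum_range_add_sum_Ico _ h]
    congr 1
    · exact Finset.sum_congr rfl fun i hi => by
        simp [splice, Finset.mem_range.1 hi]
    · exact Finset.sum_congr rfl fun i hi => by
        simp [splice, not_lt.2 (Finset.mem_Ico.1 hi).1]
  rw [h1, h2]; ring

theorem splice_mem_thickPast {e : ℝ} {b : ℕ → Bool} {A : SL2R} (h : (b, A) ∈ thickPast e)
    (n : ℕ) (c : ℕ → Bool) :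
    (splice n c b, unip (intSum n b - intSum n c) * A) ∈ thickPast e := by
  intro m
  refine back_mem_thickFwd_of_le (le_max_left m n) ?_
  rw [back, intSum_splice (le_max_right m n), ← mul_assoc, mul_assoc _ (unip _) (unip _),
    unip_mul_unip]
  have := h (max m n)
  rw [back] at this
  convert this using 4
  ring

theorem abs_intSum_sub_le (n : ℕ) (b c : ℕ → Bool) : |intSum n b - intSum n c| ≤ 3 ^ n := by
  induction n with
  | zero => simp [intSum]
  | succ n ih =>
    have h : intSum (n + 1) b - intSum (n + 1) c =
        (intSum n b - intSum n c) + (cantorDigit (b n) - cantorDigit (c n)) * 3 ^ n := by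
      simp only [intSum, Finset.sum_range_succ]; ring
    have h2 : |cantorDigit (b n) - cantorDigit (c n)| ≤ 2 := by
      rw [abs_le]
      constructor <;> linarith [cantorDigit_nonneg (b n), cantorDigit_nonneg (c n),
        cantorDigit_le_two (b n), cantorDigit_le_two (c n)]
    rw [h]
    refine (abs_add_le _ _).trans ?_
    rw [abs_mul, abs_of_pos (by positivity : (0 : ℝ) < 3 ^ n), pow_succ]
    nlinarith [pow_pos (by norm_num : (0 : ℝ) < 3) n]

theorem thickPast_nonempty {e : ℝ} (he : 0 < e) {A : SL2R} (hA : A ∈ thickFwd e) :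
    (thickPast e).Nonempty := by
  have hs : ∀ n, intSum n (fun _ => false) = 0 := fun n => by simp [intSum, cantorDigit]
  have hpow : ∀ n, diag3 ^ n * A ∈ thickFwd e := fun n => by
    induction n with
    | zero => simpa using hA
    | succ n ih =>
      have := walkStep_mem_thickFwd ih false
      simpa [walkStep, cantorDigit, unip_zero, pow_succ', mul_assoc] using this
  choose γ hγ using fun n =>
    exists_mul_intMat_mem_boundedMat he (mem_thick_of_mem_thickFwd (hpow n))
  obtain ⟨B, -, φ, hφ, hlim⟩ := (isCompact_boundedMat _).tendsto_subseq hγ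
  refine ⟨(fun _ => false, B), fun m => ?_⟩
  have hback : ∀ C, back m (fun _ => false) C = diag3⁻¹ ^ m * C := fun C => by
    rw [back, hs, unip_zero, mul_one]
  rw [hback]
  refine (isClosed_thickFwd e).mem_of_tendsto (hlim.const_mul (diag3⁻¹ ^ m)) ?_
  filter_upwards [Filter.eventually_ge_atTop m] with k hk
  have hk' : m ≤ φ k := hk.trans hφ.le_apply
  have h1 := mul_intMat_mem_thickFwd (hpow (φ k - m)) (γ (φ k))
  convert h1 using 1
  rw [Function.comp_apply, ← mul_assoc, ← mul_assoc, inv_pow]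
  congr 2
  rw [inv_mul_eq_iff_eq_mul, ← pow_add, Nat.add_sub_cancel' hk']

/-! ### Minimal invariant sets -/

/-- Closed subsets of `thickPast e` invariant under the integer matrices and under changes of the
recent past. -/
structure IsPastInvariant (e : ℝ) (Y : Set ((ℕ → Bool) × SL2R)) : Prop where
  isClosed : IsClosed Y
  nonempty : Y.Nonempty
  subset : Y ⊆ thickPast e
  mul_intMat_mem : ∀ b A, (b, A) ∈ Y → ∀ γ, (b, A * intMat γ) ∈ Y
  splice_mem : ∀ b A, (b, A) ∈ Y → ∀ n c,
    (splice n c b, unip (intSum n b - intSum n c) * A) ∈ Y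

theorem isPastInvariant_thickPast {e : ℝ} (h : (thickPast e).Nonempty) :
    IsPastInvariant e (thickPast e) where
  isClosed := isClosed_thickPast e
  nonempty := h
  subset := subset_rfl
  mul_intMat_mem b A h γ n := by
    rw [back, ← mul_assoc]; exact mul_intMat_mem_thickFwd (h n) γ
  splice_mem _ _ h n c := splice_mem_thickPast h n c

theorem mem_thick_of_mem_thickPast {e : ℝ} {b : ℕ → Bool} {A : SL2R} (h : (b, A) ∈ thickPast e) :
    A ∈ thick e := by
  have := mem_thick_of_mem_thickFwd (h 0)
  simpa [back, intSum, unip_zero] using this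

namespace IsPastInvariant

variable {e : ℝ} {Y : Set ((ℕ → Bool) × SL2R)}

theorem exists_mem_boundedMat (he : 0 < e) (hY : IsPastInvariant e Y) {b : ℕ → Bool} {A : SL2R}
    (h : (b, A) ∈ Y) : ∃ γ, A * intMat γ ∈ boundedMat √(2 / e) ∧ (b, A * intMat γ) ∈ Y := by
  obtain ⟨γ, hγ⟩ := exists_mul_intMat_mem_boundedMat he (mem_thick_of_mem_thickPast (hY.subset h))
  exact ⟨γ, hγ, hY.mul_intMat_mem b A h γ⟩

theorem exists_minimal (he : 0 < e) (hY : IsPastInvariant e Y) :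
    ∃ Z, Minimal (IsPastInvariant e) Z := by
  have hK : IsCompact ((Set.univ : Set (ℕ → Bool)) ×ˢ boundedMat √(2 / e)) :=
    isCompact_univ.prod (isCompact_boundedMat _)
  obtain ⟨Z, hZ⟩ := zorn_superset_nonempty {Z | IsPastInvariant e Z} (fun c hc hchain hne => by
    refine ⟨⋂₀ c, ?_, fun s hs => Set.sInter_subset_of_mem hs⟩
    obtain ⟨Z₀, hZ₀⟩ := hne
    have h_int : (⋂ Z : c, (Z : Set ((ℕ → Bool) × SL2R)) ∩ Set.univ ×ˢ boundedMat √(2 / e)).Nonempty := by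
      have : Nonempty c := ⟨⟨Z₀, hZ₀⟩⟩
      refine IsCompact.nonempty_iInter_of_directed_nonempty_isCompact_isClosed _ ?_ ?_ ?_ ?_
      · intro Z Z'
        rcases hchain.total Z.2 Z'.2 with h | h
        · exact ⟨Z, subset_rfl, Set.inter_subset_inter_left _ h⟩
        · exact ⟨Z', Set.inter_subset_inter_left _ h, subset_rfl⟩
      · intro Z
        obtain ⟨⟨b, A⟩, h⟩ := (hc Z.2).nonempty
        obtain ⟨γ, h1, h2⟩ := (hc Z.2).exists_mem_boundedMat he h
        exact ⟨_, h2, trivial, h1⟩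
      · intro Z
        exact hK.inter_left (hc Z.2).isClosed
      · intro Z
        exact (hc Z.2).isClosed.inter hK.isClosed
    obtain ⟨y, hy⟩ := h_int
    exact
      { isClosed := isClosed_sInter fun Z hZ => (hc hZ).isClosed
        nonempty := ⟨y, fun Z hZ => (Set.mem_iInter.1 hy ⟨Z, hZ⟩).1⟩
        subset := (Set.sInter_subset_of_mem hZ₀).trans (hc hZ₀).subset
        mul_intMat_mem := fun b A h γ Z hZ => (hc hZ).mul_intMat_mem b A (h Z hZ) γ
        splice_mem := fun b A h n d Z hZ => (hc hZ).splice_mem b A (h Z hZ) n d }) Y hY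
  exact ⟨Z, hZ.2⟩

theorem unip_mem_of_minimal (hY : Minimal (IsPastInvariant e) Y) {r : ℝ} {b₀ : ℕ → Bool}
    {A₀ : SL2R} (h₀ : (b₀, A₀) ∈ Y) (h₁ : (b₀, unip r * A₀) ∈ Y) :
    ∀ b A, (b, A) ∈ Y → (b, unip r * A) ∈ Y := by
  set Z : Set ((ℕ → Bool) × SL2R) := {y | y ∈ Y ∧ (y.1, unip r * y.2) ∈ Y} with hZdef
  have hZ : IsPastInvariant e Z :=
    { isClosed := hY.prop.isClosed.inter (hY.prop.isClosed.preimage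
        (continuous_fst.prodMk (continuous_const.mul continuous_snd)))
      nonempty := ⟨_, h₀, h₁⟩
      subset := fun y hy => hY.prop.subset hy.1
      mul_intMat_mem := fun b A h γ => ⟨hY.prop.mul_intMat_mem b A h.1 γ, by
        rw [← mul_assoc]; exact hY.prop.mul_intMat_mem _ _ h.2 γ⟩
      splice_mem := fun b A h n c => ⟨hY.prop.splice_mem b A h.1 n c, by
        have := hY.prop.splice_mem _ _ h.2 n c
        rw [← mul_assoc, unip_mul_unip] at this ⊢
        rwa [add_comm]⟩ }
  intro b A h
  exact (hY.le_of_le hZ (fun y hy => hy.1) h).2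

end IsPastInvariant

theorem lat_diag3_inv_pow_zero (n : ℕ) (A : SL2R) (p q : ℤ) :
    lat (diag3⁻¹ ^ n * A) 0 p q = (√3)⁻¹ ^ n * lat A 0 p q := by
  induction n with
  | zero => simp
  | succ n ih =>
    have h := lat_diag3_zero (diag3⁻¹ ^ (n + 1) * A) p q
    rw [pow_succ', ← mul_assoc, ← mul_assoc, mul_inv_cancel, one_mul, ih] at h
    rw [pow_succ', pow_succ', mul_assoc _ _ (lat _ _ _ _), h, ← mul_assoc,
      inv_mul_cancel₀ (by positivity), one_mul]

theorem lat_diag3_inv_pow_one (n : ℕ) (A : SL2R) (p q : ℤ) :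
    lat (diag3⁻¹ ^ n * A) 1 p q = (√3) ^ n * lat A 1 p q := by
  induction n with
  | zero => simp
  | succ n ih =>
    have h := lat_diag3_one (diag3⁻¹ ^ (n + 1) * A) p q
    rw [pow_succ', ← mul_assoc, ← mul_assoc, mul_inv_cancel, one_mul, ih] at h
    rw [pow_succ', pow_succ', mul_assoc _ _ (lat _ _ _ _), h, ← mul_assoc,
      mul_inv_cancel₀ (by positivity), one_mul]

theorem le_of_mem_thickPast {e : ℝ} {b : ℕ → Bool} {A : SL2R} (h : (b, A) ∈ thickPast e) {p q : ℤ}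
    (hpq : p ≠ 0 ∨ q ≠ 0) (n : ℕ) :
    e ≤ 2 * lat A 0 p q ^ 2 / 3 ^ n + 3 * 3 ^ n * lat A 1 p q ^ 2 := by
  have h1 := mem_thick_of_mem_thickFwd (h n) p q hpq
  simp only [back] at h1
  rw [mul_assoc, lat_diag3_inv_pow_zero, lat_diag3_inv_pow_one, lat_unip_zero, lat_unip_one] at h1
  set v := lat A 0 p q
  set w := lat A 1 p q
  set s := intSum n b
  have hs : |s| ≤ 3 ^ n := by
    have := abs_intSum_sub_le n b fun _ => false
    simpa [s, intSum, cantorDigit] using this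
  have h3 : (√3) ^ 2 = 3 := Real.sq_sqrt (by norm_num)
  have h4 : ((√3)⁻¹ ^ n * (v + s * w)) ^ 2 = (v + s * w) ^ 2 / 3 ^ n := by
    rw [mul_pow, ← pow_mul, mul_comm n 2, pow_mul, inv_pow, h3, inv_pow]; ring
  have h5 : (√3 ^ n * w) ^ 2 = 3 ^ n * w ^ 2 := by
    rw [mul_pow, ← pow_mul, mul_comm n 2, pow_mul, h3]
  rw [h4, h5] at h1
  refine h1.trans ?_
  have h6 : (v + s * w) ^ 2 ≤ 2 * v ^ 2 + 2 * (3 ^ n) ^ 2 * w ^ 2 := by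
    have : s ^ 2 ≤ (3 ^ n) ^ 2 := sq_le_sq' (by linarith [(abs_le.1 hs).1]) (abs_le.1 hs).2
    nlinarith [sq_nonneg (v - s * w), sq_nonneg w]
  have h7 : (v + s * w) ^ 2 / 3 ^ n ≤ (2 * v ^ 2 + 2 * (3 ^ n) ^ 2 * w ^ 2) / 3 ^ n := by gcongr
  have h8 : (2 * v ^ 2 + 2 * (3 ^ n) ^ 2 * w ^ 2) / 3 ^ n = 2 * v ^ 2 / 3 ^ n + 2 * 3 ^ n * w ^ 2 := by
    field_simp
  linarith

theorem exists_lat_one_sq_lt (A : SL2R) {e : ℝ} (he : 0 < e) :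
    ∃ p q : ℤ, (p ≠ 0 ∨ q ≠ 0) ∧ lat A 1 p q ^ 2 < e := by
  by_cases h0 : A 1 0 = 0
  · exact ⟨1, 0, by simp, by simp [lat, h0, he]⟩
  · obtain ⟨n, hn⟩ := exists_nat_gt (|A 1 0| / √e)
    obtain ⟨j, k, hk, -, hjk⟩ := Real.exists_int_int_abs_mul_sub_le (A 1 1 / A 1 0) n.succ_pos
    refine ⟨-j, k, Or.inr hk.ne', ?_⟩
    have h1 : lat A 1 (-j) k = A 1 0 * (k * (A 1 1 / A 1 0) - j) := by
      simp only [lat]; push_cast; field_simp; ring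
    rw [h1, ← Real.sq_sqrt he.le, sq_lt_sq, abs_mul, abs_of_pos (Real.sqrt_pos.2 he)]
    rw [div_lt_iff₀ (Real.sqrt_pos.2 he)] at hn
    push_cast at hjk
    have hn0 : (0 : ℝ) ≤ n := n.cast_nonneg
    calc _ ≤ |A 1 0| * (1 / (n + 1 + 1)) := by gcongr
      _ < √e := by
        rw [mul_one_div, div_lt_iff₀ (by positivity)]
        nlinarith [Real.sqrt_pos.2 he]

namespace IsPastInvariant

variable {e : ℝ} {Y : Set ((ℕ → Bool) × SL2R)}

theorem not_unip_invariant (he : 0 < e) (hY : IsPastInvariant e Y)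
    (h : ∀ r b A, (b, A) ∈ Y → (b, unip r * A) ∈ Y) : False := by
  obtain ⟨⟨b, A⟩, hA⟩ := hY.nonempty
  obtain ⟨p, q, hpq, hlt⟩ := exists_lat_one_sq_lt A he
  by_cases h0 : lat A 1 p q = 0
  · obtain ⟨n, hn⟩ := pow_unbounded_of_one_lt (2 * lat A 0 p q ^ 2 / e) (by norm_num : (1 : ℝ) < 3)
    have := le_of_mem_thickPast (hY.subset hA) hpq n
    rw [h0] at this
    rw [div_lt_iff₀ he] at hn
    have h1 : 2 * lat A 0 p q ^ 2 / 3 ^ n < e := by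
      rw [div_lt_iff₀ (by positivity)]; linarith
    simp at this
    linarith
  · have h1 := mem_thick_of_mem_thickPast (hY.subset (h (-(lat A 0 p q / lat A 1 p q)) b A hA)) p q hpq
    rw [lat_unip_zero, lat_unip_one, neg_mul, div_mul_cancel₀ _ h0] at h1
    simp at h1
    linarith

theorem unip_invariant_of_recurrent (hY : Minimal (IsPastInvariant e) Y)
    (h : ∀ τ : ℝ, 0 < τ → ∃ r b A, τ ≤ |r| ∧ |r| ≤ 400 * τ ∧ (b, A) ∈ Y ∧ (b, unip r * A) ∈ Y) :
    ∀ r b A, (b, A) ∈ Y → (b, unip r * A) ∈ Y := by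
  let S : AddSubgroup ℝ :=
    { carrier := {r | ∀ b A, (b, A) ∈ Y → (b, unip r * A) ∈ Y}
      zero_mem' := fun b A hA => by rwa [unip_zero, one_mul]
      add_mem' := fun {r t} hr ht b A hA => by
        rw [← unip_mul_unip, mul_assoc]; exact hr _ _ (ht _ _ hA)
      neg_mem' := fun {r} hr => by
        obtain ⟨⟨b, A⟩, hA⟩ := hY.prop.nonempty
        refine unip_mem_of_minimal hY (hr b A hA) ?_
        rwa [← mul_assoc, unip_mul_unip, neg_add_cancel, unip_zero, one_mul] }
  have hSmem : ∀ r, r ∈ S ↔ ∀ b A, (b, A) ∈ Y → (b, unip r * A) ∈ Y := fun r => Iff.rfl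
  have hclosed : IsClosed (S : Set ℝ) := by
    have : (S : Set ℝ) = ⋂ y : Y, {r | (y.1.1, unip r * y.1.2) ∈ Y} := by
      ext r
      simp [hSmem, Set.mem_iInter]
    rw [this]
    exact isClosed_iInter fun y => hY.prop.isClosed.preimage
      (continuous_const.prodMk (continuous_unip.mul continuous_const))
  have hdense : Dense (S : Set ℝ) := by
    refine S.dense_of_not_isolated_zero fun ε hε => ?_
    obtain ⟨r, b, A, hr1, hr2, hA, hrA⟩ := h (ε / 800) (by positivity)
    have hr : r ∈ S := (hSmem r).2 (unip_mem_of_minimal hY hA hrA)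
    refine ⟨|r|, ?_, lt_of_lt_of_le (by positivity) hr1, by linarith⟩
    rcases abs_choice r with h | h <;> rw [h]
    exacts [hr, S.neg_mem hr]
  intro r
  have hu : (S : Set ℝ) = Set.univ := by rw [← hclosed.closure_eq, hdense.closure_eq]
  exact (hSmem r).1 (show r ∈ (S : Set ℝ) from hu ▸ Set.mem_univ r)

end IsPastInvariant

/-- The upper right entry of `unip s * δ * unip (-s)`. -/
def shear (δ : SL2R) (s : ℝ) : ℝ := δ 0 1 + s * (δ 1 1 - δ 0 0) - s ^ 2 * δ 1 0

/-- A neighbourhood of the identity. -/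
def nearOne (ε : ℝ) : Set SL2R :=
  {δ | |δ 0 0 - 1| < ε ∧ |δ 0 1| < ε ∧ |δ 1 0| < ε ∧ |δ 1 1 - 1| < ε}

theorem isOpen_nearOne (ε : ℝ) : IsOpen (nearOne ε) := by
  have h := continuous_SL2R_apply
  exact (isOpen_lt ((h 0 0).sub continuous_const).abs continuous_const).inter
    ((isOpen_lt (h 0 1).abs continuous_const).inter
    ((isOpen_lt (h 1 0).abs continuous_const).inter
    (isOpen_lt ((h 1 1).sub continuous_const).abs continuous_const)))

theorem one_mem_nearOne {ε : ℝ} (hε : 0 < ε) : (1 : SL2R) ∈ nearOne ε := by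
  simp [nearOne, hε]

theorem unip_conj_apply (s : ℝ) (δ : SL2R) :
    (unip s * δ * unip (-s)) 0 0 = δ 0 0 + s * δ 1 0 ∧
    (unip s * δ * unip (-s)) 0 1 = shear δ s ∧
    (unip s * δ * unip (-s)) 1 0 = δ 1 0 ∧
    (unip s * δ * unip (-s)) 1 1 = δ 1 1 - s * δ 1 0 := by
  simp only [SL2R_mul_apply, unip_apply, shear]
  refine ⟨by ring, by ring, by ring, by ring⟩

theorem intSum_update (n i : ℕ) (hi : i < n) (b : ℕ → Bool) (d : Bool) :
    intSum n (Function.update b i d) = intSum n b - (cantorDigit (b i) - cantorDigit d) * 3 ^ i := by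
  rw [intSum, intSum, ← Finset.add_sum_erase _ _ (Finset.mem_range.2 hi),
    ← Finset.add_sum_erase (Finset.range n) (fun j => cantorDigit (b j) * 3 ^ j) (Finset.mem_range.2 hi)]
  rw [Finset.sum_congr rfl (g := fun j => cantorDigit (b j) * 3 ^ j) fun j hj => by
    rw [Function.update_of_ne (Finset.ne_of_mem_erase hj)]]
  rw [Function.update_self]
  ring

theorem exists_intSum_sub_update (n i : ℕ) (hi : i < n) (b : ℕ → Bool) :
    ∃ σ : ℝ, (σ = 1 ∨ σ = -1) ∧
      intSum n b - intSum n (Function.update b i (!b i)) = σ * (2 * 3 ^ i) := by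
  rw [intSum_update n i hi]
  cases b i
  · exact ⟨-1, .inr rfl, by simp [cantorDigit]⟩
  · exact ⟨1, .inl rfl, by simp [cantorDigit]⟩

theorem coeff_le_of_shear_le {δ : SL2R} {τ : ℝ} {n : ℕ} (hn : 2 ≤ n) {b : ℕ → Bool}
    (h : ∀ c, |shear δ (intSum n b - intSum n c)| ≤ τ) :
    |δ 0 1| ≤ τ ∧ |δ 1 1 - δ 0 0| ≤ 21 * τ / 3 ^ n ∧ |δ 1 0| ≤ 27 * τ / 9 ^ n := by
  obtain ⟨m, rfl⟩ := Nat.exists_eq_add_of_le' hn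
  have h0 := h b
  obtain ⟨σ, hσ, h1⟩ := exists_intSum_sub_update (m + 2) m (by omega) b
  obtain ⟨σ', hσ', h2⟩ := exists_intSum_sub_update (m + 2) (m + 1) (by omega) b
  have h1' := h (Function.update b m (!b m))
  have h2' := h (Function.update b (m + 1) (!b (m + 1)))
  rw [h1] at h1'
  rw [h2] at h2'
  rw [sub_self] at h0
  have e9 : (9 : ℝ) ^ (m + 2) = 81 * (3 ^ m * 3 ^ m) := by rw [← mul_pow, pow_add]; norm_num; ring
  have e3 : (3 : ℝ) ^ (m + 2) = 9 * 3 ^ m := by rw [pow_add]; ring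
  rw [le_div_iff₀ (by positivity), le_div_iff₀ (by positivity), e9, e3]
  rw [pow_succ] at h2'
  have hp : (0 : ℝ) < 3 ^ m := by positivity
  generalize (3 : ℝ) ^ m = t at *
  have a1 : |δ 1 1 - δ 0 0| * (9 * t) = |9 * (t * (δ 1 1 - δ 0 0))| := by
    rw [abs_mul, abs_mul, abs_of_pos hp, abs_of_pos (by norm_num : (0 : ℝ) < 9)]; ring
  have a2 : |δ 1 0| * (81 * (t * t)) = |81 * (t ^ 2 * δ 1 0)| := by
    rw [abs_mul, abs_mul, abs_of_pos (pow_pos hp 2), abs_of_pos (by norm_num : (0 : ℝ) < 81)]; ring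
  rw [a1, a2]
  have c1 : shear δ (σ * (2 * t)) = δ 0 1 + 2 * σ * (t * (δ 1 1 - δ 0 0)) - 4 * (t ^ 2 * δ 1 0) := by
    have : σ ^ 2 = 1 := by rcases hσ with rfl | rfl <;> norm_num
    rw [shear]; linear_combination (-4 * t ^ 2 * δ 1 0) * this
  have c2 : shear δ (σ' * (2 * (t * 3))) =
      δ 0 1 + 6 * σ' * (t * (δ 1 1 - δ 0 0)) - 36 * (t ^ 2 * δ 1 0) := by
    have : σ' ^ 2 = 1 := by rcases hσ' with rfl | rfl <;> norm_num
    rw [shear]; linear_combination (-36 * t ^ 2 * δ 1 0) * this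
  rw [c1] at h1'
  rw [c2] at h2'
  have c0 : shear δ 0 = δ 0 1 := by simp [shear]
  rw [c0] at h0
  generalize t * (δ 1 1 - δ 0 0) = B at *
  generalize t ^ 2 * δ 1 0 = C at *
  refine ⟨h0, ?_⟩
  rw [abs_le] at *
  rw [abs_le]
  rcases hσ with rfl | rfl <;> rcases hσ' with rfl | rfl <;>
    refine ⟨⟨?_, ?_⟩, ?_, ?_⟩ <;> linarith

namespace IsPastInvariant

variable {e : ℝ} {Y : Set ((ℕ → Bool) × SL2R)}

theorem exists_drift (he : 0 < e) (hY : IsPastInvariant e Y) {τ : ℝ} (hτ : 0 < τ) (k n : ℕ)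
    {b b' : ℕ → Bool} {A δ : SL2R} (h : (b, A) ∈ Y) (h' : (b', δ * A) ∈ Y)
    (hbb : ∀ i < n, b i = b' i) (hδ : δ ∈ nearOne (τ / 9 ^ (k + 6)))
    (hbad : ∃ c, τ < |shear δ (intSum n b - intSum n c)|) :
    ∃ (b₁ b₁' : ℕ → Bool) (B D : SL2R), (b₁, B) ∈ Y ∧ (b₁', D * B) ∈ Y ∧ (∀ i < k, b₁ i = b₁' i) ∧
      B ∈ boundedMat √(2 / e) ∧ τ ≤ |D 0 1| ∧ |D 0 1| ≤ 400 * τ ∧ |D 0 0 - 1| ≤ 2 * τ / 3 ^ k ∧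
      |D 1 0| ≤ 2 * τ / 3 ^ k ∧ |D 1 1 - 1| ≤ 2 * τ / 3 ^ k := by
  classical
  have hex : ∃ N, N ≤ n ∧ ∃ c, τ < |shear δ (intSum N b - intSum N c)| := ⟨n, le_rfl, hbad⟩
  set N := Nat.find hex with hN
  obtain ⟨hNn, c, hc⟩ := Nat.find_spec hex
  rw [← hN] at hNn hc
  have hmin : ∀ M < N, ∀ c, |shear δ (intSum M b - intSum M c)| ≤ τ := fun M hM c => by
    have := Nat.find_min hex hM
    push Not at this
    exact this (by omega) c
  set s := intSum N b - intSum N c with hs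
  have hs3 : |s| ≤ 3 ^ N := abs_intSum_sub_le N b c
  obtain ⟨d00, d01, d10, d11⟩ := hδ
  set ε := τ / 9 ^ (k + 6) with hε
  have hε0 : 0 < ε := by positivity
  have hs2 : s ^ 2 ≤ 9 ^ N := by
    rw [← sq_abs]
    calc |s| ^ 2 ≤ (3 ^ N) ^ 2 := by gcongr
      _ = 9 ^ N := by rw [← pow_mul, mul_comm, pow_mul]; norm_num
  have h39 : (3 : ℝ) ^ N ≤ 9 ^ N := by gcongr; norm_num
  have h19 : (1 : ℝ) ≤ 9 ^ N := one_le_pow₀ (by norm_num)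
  have hdiff : |δ 1 1 - δ 0 0| ≤ 2 * ε := by
    rw [abs_lt] at d00 d11; rw [abs_le]; constructor <;> linarith
  have hsh : ∀ p q r : ℝ, |δ 0 1| ≤ p → |δ 1 1 - δ 0 0| ≤ q → |δ 1 0| ≤ r →
      |shear δ s| ≤ p + 3 ^ N * q + 9 ^ N * r := fun p q r hp hq hr => by
    have hq0 : 0 ≤ q := (abs_nonneg _).trans hq
    have hr0 : 0 ≤ r := (abs_nonneg _).trans hr
    calc |shear δ s| ≤ |δ 0 1 + s * (δ 1 1 - δ 0 0)| + |s ^ 2 * δ 1 0| := abs_sub _ _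
      _ ≤ |δ 0 1| + |s * (δ 1 1 - δ 0 0)| + |s ^ 2 * δ 1 0| := by gcongr; exact abs_add_le _ _
      _ ≤ _ := by
        rw [abs_mul, abs_mul, abs_of_nonneg (sq_nonneg s)]
        gcongr
  have hNk : k + 6 ≤ N := by
    by_contra! hlt
    have h1 := hsh ε (2 * ε) ε d01.le hdiff d10.le
    have h2 : (9 : ℝ) ^ (k + 6) = 9 * 9 ^ (k + 5) := by ring
    have h3 : (9 : ℝ) ^ N ≤ 9 ^ (k + 5) := by gcongr; norm_num; omega
    have h4 : ε * (9 * 9 ^ (k + 5)) = τ := by rw [hε, h2]; field_simp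
    nlinarith
  obtain ⟨M, hM⟩ := Nat.exists_eq_add_of_le' (show 1 ≤ N by omega)
  obtain ⟨q01, qd, q10⟩ := coeff_le_of_shear_le (δ := δ) (b := b) (τ := τ) (n := M) (by omega)
    (hmin M (by omega))
  have p3 : (3 : ℝ) ^ N = 3 * 3 ^ M := by rw [hM]; ring
  have p9 : (9 : ℝ) ^ N = 9 * 9 ^ M := by rw [hM]; ring
  have h93 : (9 : ℝ) ^ M = 3 ^ M * 3 ^ M := by rw [← mul_pow]; norm_num
  have hkM : (3 : ℝ) ^ (k + 5) ≤ 3 ^ M := by gcongr; norm_num; omega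
  have hk5 : (3 : ℝ) ^ (k + 5) = 243 * 3 ^ k := by ring
  have hk9 : (3 : ℝ) ^ k ≤ 9 ^ (k + 6) := by
    calc (3 : ℝ) ^ k ≤ 9 ^ k := by gcongr; norm_num
      _ ≤ _ := by gcongr; norm_num; omega
  have hεk : ε ≤ τ / 3 ^ k := by rw [hε]; gcongr
  have hsd : |s * δ 1 0| ≤ τ / 3 ^ k := by
    rw [abs_mul]
    calc |s| * |δ 1 0| ≤ 3 ^ N * (27 * τ / 9 ^ M) := by gcongr
      _ = 81 * τ / 3 ^ M := by rw [p3, h93]; field_simp; norm_num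
      _ ≤ 81 * τ / (243 * 3 ^ k) := by rw [← hk5]; gcongr
      _ ≤ τ / 3 ^ k := by
        rw [div_le_div_iff₀ (by positivity) (by positivity)]
        nlinarith [mul_pos hτ (show (0 : ℝ) < 3 ^ k by positivity)]
  obtain ⟨e00, e01, e10, e11⟩ := unip_conj_apply s δ
  obtain ⟨γ, hγ, hγY⟩ := hY.exists_mem_boundedMat he (hY.splice_mem b A h N c)
  have h2 : 2 * τ / 3 ^ k = τ / 3 ^ k + τ / 3 ^ k := by ring
  refine ⟨_, splice N c b', _, unip s * δ * unip (-s), hγY, ?_, ?_, hγ, ?_, ?_, ?_, ?_, ?_⟩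
  · have h1 := hY.mul_intMat_mem _ _ (hY.splice_mem b' _ h' N c) γ
    rw [← intSum_congr fun i hi => hbb i (by omega), ← hs] at h1
    convert h1 using 2
    rw [← hs]
    have : unip (-s) * unip s = 1 := by rw [unip_mul_unip, neg_add_cancel, unip_zero]
    calc _ = unip s * δ * (unip (-s) * unip s) * A * intMat γ := by simp only [mul_assoc]
      _ = _ := by rw [this]; simp only [mul_assoc, one_mul]
  · intro i hi
    simp only [splice]
    rw [if_pos (by omega), if_pos (by omega)]
  · rw [e01]; exact hc.le
  · rw [e01]
    refine (hsh _ _ _ q01 qd q10).trans ?_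
    have : τ + 3 ^ N * (21 * τ / 3 ^ M) + 9 ^ N * (27 * τ / 9 ^ M) = 307 * τ := by
      rw [p3, p9]; field_simp; norm_num
    rw [this]; linarith
  · rw [e00, h2]
    calc _ = |(δ 0 0 - 1) + s * δ 1 0| := by ring_nf
      _ ≤ _ := abs_add_le _ _
      _ ≤ _ := add_le_add (d00.le.trans hεk) hsd
  · rw [e10, h2]
    have : 0 ≤ τ / 3 ^ k := by positivity
    linarith
  · rw [e11, h2]
    calc _ = |(δ 1 1 - 1) - s * δ 1 0| := by ring_nf
      _ ≤ _ := abs_sub _ _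
      _ ≤ _ := add_le_add (d11.le.trans hεk) hsd

theorem exists_shear_le (he : 0 < e) (hY : IsPastInvariant e Y) {τ : ℝ} (hτ : 0 < τ)
    (hno : ∀ r b A, τ ≤ |r| → |r| ≤ 400 * τ → (b, A) ∈ Y → (b, unip r * A) ∉ Y) :
    ∃ ε > 0, ∀ (n : ℕ) (b b' : ℕ → Bool) (A δ : SL2R), (b, A) ∈ Y → (b', δ * A) ∈ Y →
      (∀ i < n, b i = b' i) → δ ∈ nearOne ε →
      ∀ c, |shear δ (intSum n b - intSum n c)| ≤ τ := by
  by_contra! hcon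
  have key : ∀ k : ℕ, ∃ y : (ℕ → Bool) × (ℕ → Bool) × SL2R × SL2R,
      (y.1, y.2.2.1) ∈ Y ∧ (y.2.1, y.2.2.2 * y.2.2.1) ∈ Y ∧ (∀ i < k, y.1 i = y.2.1 i) ∧
      y.2.2.1 ∈ boundedMat √(2 / e) ∧ τ ≤ |y.2.2.2 0 1| ∧ |y.2.2.2 0 1| ≤ 400 * τ ∧
      |y.2.2.2 0 0 - 1| ≤ 2 * τ / 3 ^ k ∧
      |y.2.2.2 1 0| ≤ 2 * τ / 3 ^ k ∧ |y.2.2.2 1 1 - 1| ≤ 2 * τ / 3 ^ k := fun k => by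
    obtain ⟨n, b, b', A, δ, h, h', hbb, hδ, hbad⟩ := hcon (τ / 9 ^ (k + 6)) (by positivity)
    obtain ⟨b₁, b₁', B, D, h⟩ := hY.exists_drift he hτ k n h h' hbb hδ hbad
    exact ⟨⟨b₁, b₁', B, D⟩, h⟩
  choose y hy1 hy2 hyb hyB hl hu h00 h10 h11 using key
  have hK : IsCompact ((Set.univ : Set (ℕ → Bool)) ×ˢ (Set.univ : Set (ℕ → Bool)) ×ˢ
      boundedMat √(2 / e) ×ˢ boundedMat (400 * τ + 2 * τ + 1)) :=
    isCompact_univ.prod (isCompact_univ.prod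
      ((isCompact_boundedMat _).prod (isCompact_boundedMat _)))
  have hyK : ∀ k, y k ∈ (Set.univ : Set (ℕ → Bool)) ×ˢ (Set.univ : Set (ℕ → Bool)) ×ˢ
      boundedMat √(2 / e) ×ˢ boundedMat (400 * τ + 2 * τ + 1) := fun k => by
    refine ⟨trivial, trivial, hyB k, ?_⟩
    have hk : 2 * τ / 3 ^ k ≤ 2 * τ := div_le_self (by positivity) (one_le_pow₀ (by norm_num))
    have h1 := h00 k; have h2 := h11 k; have h3 := h10 k; have h4 := hu k
    rw [abs_le] at h1 h2 h3 h4
    intro i j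
    fin_cases i <;> fin_cases j <;> simp only [Fin.zero_eta, Fin.mk_one, Fin.isValue] <;>
      rw [abs_le] <;> constructor <;> linarith
  obtain ⟨⟨β, β', B, D⟩, -, φ, hφ, hlim⟩ := hK.tendsto_subseq hyK
  rw [Prod.tendsto_iff] at hlim
  obtain ⟨l1, hlim⟩ := hlim
  rw [Prod.tendsto_iff] at hlim
  obtain ⟨l2, hlim⟩ := hlim
  rw [Prod.tendsto_iff] at hlim
  obtain ⟨l3, l4⟩ := hlim
  simp only [Function.comp_def] at l1 l2 l3 l4
  have hββ : β = β' := by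
    funext i
    have t1 := tendsto_pi_nhds.1 l1 i
    have t2 := tendsto_pi_nhds.1 l2 i
    refine tendsto_nhds_unique (t1.congr' ?_) t2
    filter_upwards [Filter.eventually_gt_atTop i] with k hk
    exact hyb _ i (hk.trans_le (hφ.id_le k))
  subst hββ
  have hent : ∀ i j, Filter.Tendsto (fun k => (y (φ k)).2.2.2 i j) Filter.atTop (nhds (D i j)) :=
    fun i j => ((continuous_SL2R_apply i j).tendsto D).comp l4
  have hz : Filter.Tendsto (fun k => 2 * τ / (3 : ℝ) ^ φ k) Filter.atTop (nhds 0) := by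
    have : Filter.Tendsto (fun k : ℕ => 2 * τ / (3 : ℝ) ^ k) Filter.atTop (nhds 0) :=
      tendsto_const_nhds.div_atTop (tendsto_pow_atTop_atTop_of_one_lt (by norm_num))
    exact this.comp hφ.tendsto_atTop
  have e00 : D 0 0 = 1 := tendsto_nhds_unique (hent 0 0)
    (tendsto_iff_norm_sub_tendsto_zero.2 (squeeze_zero (fun _ => norm_nonneg _) (fun k => h00 (φ k)) hz))
  have e11 : D 1 1 = 1 := tendsto_nhds_unique (hent 1 1)
    (tendsto_iff_norm_sub_tendsto_zero.2 (squeeze_zero (fun _ => norm_nonneg _) (fun k => h11 (φ k)) hz))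
  have e10 : D 1 0 = 0 := tendsto_nhds_unique (hent 1 0)
    (squeeze_zero_norm (fun k => h10 (φ k)) hz)
  have hDu : D = unip (D 0 1) := by
    ext i j
    fin_cases i <;> fin_cases j <;> simp [unip_apply, e00, e11, e10]
  refine hno (D 0 1) β B (ge_of_tendsto' (hent 0 1).abs fun k => hl (φ k))
    (le_of_tendsto' (hent 0 1).abs fun k => hu (φ k))
    (hY.isClosed.mem_of_tendsto (l1.prodMk_nhds l3) (.of_forall fun k => hy1 (φ k))) ?_
  rw [← hDu]
  exact hY.isClosed.mem_of_tendsto (l2.prodMk_nhds (l4.mul l3)) (.of_forall fun k => hy2 (φ k))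

end IsPastInvariant

theorem exists_close_pair {K : Set SL2R} (hK : IsCompact K) {ε : ℝ} (hε : 0 < ε) :
    ∃ m : ℕ, ∀ B : ℕ → SL2R, (∀ i, B i ∈ K) →
      ∃ i j, i ≤ m ∧ j < i ∧ B i * (B j)⁻¹ ∈ nearOne ε := by
  have hV : ∀ x : SL2R, ∃ V ∈ nhds x, ∀ A ∈ V, ∀ B ∈ V,
      A * B⁻¹ ∈ nearOne ε ∧ B * A⁻¹ ∈ nearOne ε := fun x => by
    have hc : Continuous fun z : SL2R × SL2R => z.1 * z.2⁻¹ :=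
      continuous_fst.mul continuous_snd.inv
    have : (fun z : SL2R × SL2R => z.1 * z.2⁻¹) ⁻¹' nearOne ε ∈ nhds (x, x) := by
      refine hc.continuousAt.preimage_mem_nhds ((isOpen_nearOne ε).mem_nhds ?_)
      simpa using one_mem_nearOne hε
    obtain ⟨U, V, hU, hxU, hV, hxV, hUV⟩ := mem_nhds_prod_iff'.1 this
    refine ⟨U ∩ V, Filter.inter_mem (hU.mem_nhds hxU) (hV.mem_nhds hxV), fun A hA B hB => ?_⟩
    exact ⟨hUV (Set.mk_mem_prod hA.1 hB.2), hUV (Set.mk_mem_prod hB.1 hA.2)⟩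
  choose V hVn hV using hV
  obtain ⟨t, -, ht⟩ := hK.elim_nhds_subcover V fun x _ => hVn x
  refine ⟨t.card, fun B hB => ?_⟩
  have h1 : ∀ i, ∃ x ∈ t, B i ∈ V x := fun i => by simpa using ht (hB i)
  choose f hft hfV using h1
  obtain ⟨i, hi, j, hj, hij, hf⟩ := Finset.exists_ne_map_eq_of_card_lt_of_maps_to
    (s := Finset.range (t.card + 1)) (t := t) (f := f) (by simp) fun i _ => hft i
  have hi := Finset.mem_range.1 hi
  have hj := Finset.mem_range.1 hj
  have h2 := hV (f i) (B i) (hfV i) (B j) (hf ▸ hfV j)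
  rcases lt_or_gt_of_ne hij with h | h
  · exact ⟨j, i, by omega, h, h2.2⟩
  · exact ⟨i, j, by omega, h, h2.1⟩

/-- Integer matrices of trace zero and determinant zero have rank one. -/
theorem exists_eq_of_sq_add_mul_eq_zero {a b c : ℤ} (h : a ^ 2 + b * c = 0)
    (hne : b ≠ 0 ∨ c ≠ 0) :
    ∃ k x y : ℤ, k ≠ 0 ∧ (x ≠ 0 ∨ y ≠ 0) ∧ a = -(k * x * y) ∧ b = k * x ^ 2 ∧ c = -(k * y ^ 2) := by
  by_cases hb : b = 0
  · subst hb
    have ha : a = 0 := by simpa using h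
    refine ⟨-c, 0, 1, by simpa using hne, by simp, by simp [ha], by simp, by simp⟩
  · have hg : 0 < Int.gcd b (-a) := Int.gcd_pos_of_ne_zero_left _ hb
    obtain ⟨g, x, y, hg0, hco, hbx, hay⟩ := Int.exists_gcd_one' hg
    have hg' : (g : ℤ) ≠ 0 := by exact_mod_cast hg0.ne'
    have hx : x ≠ 0 := by rintro rfl; simp at hbx; exact hb hbx
    have h1 : g * y ^ 2 = -(x * c) := by
      have ha : a = -(y * g) := by linarith
      rw [ha, hbx] at h
      have : (g : ℤ) * (g * y ^ 2) = g * (-(x * c)) := by linear_combination h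
      exact mul_left_cancel₀ hg' this
    have hxg : x ∣ (g : ℤ) := by
      have hco' : IsCoprime x (y ^ 2) := (Int.isCoprime_iff_gcd_eq_one.2 hco).pow_right
      refine hco'.dvd_of_dvd_mul_right ?_
      rw [h1]; exact (dvd_mul_right x c).neg_right
    obtain ⟨k, hk⟩ := hxg
    refine ⟨k, x, y, ?_, .inl hx, ?_, ?_, ?_⟩
    · rintro rfl; simp at hk; omega
    · rw [hk] at hay; linarith
    · rw [hbx, hk]; ring
    · rw [hk] at h1
      have : x * (-(k * y ^ 2)) = x * c := by linear_combination -h1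
      exact (mul_left_cancel₀ hx this).symm

theorem SL2R_inv_apply (A : SL2R) :
    A⁻¹ 0 0 = A 1 1 ∧ A⁻¹ 0 1 = -A 0 1 ∧ A⁻¹ 1 0 = -A 1 0 ∧ A⁻¹ 1 1 = A 0 0 := by
  simp [Matrix.SpecialLinearGroup.coe_inv, Matrix.adjugate_fin_two]

theorem exists_short_of_almost_unip {δ A : SL2R} {γ : SL2Z} {t : ℝ}
    (h : unip (-t) * δ * A = A * intMat γ) (hδ : δ ∈ nearOne (1 / 8)) (ht : 4 ≤ |t|)
    (htδ : |t * δ 1 0| < 1 / 2) :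
    ∃ p q : ℤ, (p ≠ 0 ∨ q ≠ 0) ∧ lat A 0 p q ^ 2 ≤ 2 * |t| ∧ lat A 1 p q ^ 2 ≤ |δ 1 0| := by
  have hE : unip (-t) * δ = A * intMat γ * A⁻¹ := by rw [← h]; group
  have hent : ∀ i j, (unip (-t) * δ) i j = (A * intMat γ * A⁻¹) i j := fun i j => by rw [hE]
  have h00 := hent 0 0
  have h01 := hent 0 1
  have h10 := hent 1 0
  have h11 := hent 1 1
  obtain ⟨v1, v2, v3, v4⟩ := SL2R_inv_apply A
  simp only [SL2R_mul_apply, unip_apply, intMat_apply, v1, v2, v3, v4] at h00 h01 h10 h11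
  have hdet := SL2R_det A
  have hdγ := SL2Z_det γ
  obtain ⟨d00, d01, d10, d11⟩ := hδ
  rw [abs_lt] at d00 d01 d11 htδ
  have htr : ((γ 0 0 : ℝ) + γ 1 1) = δ 0 0 - t * δ 1 0 + δ 1 1 := by
    linear_combination -h00 - h11 - ((γ 0 0 : ℝ) + γ 1 1) * hdet
  have htr2 : γ 0 0 + γ 1 1 = 2 := by
    have l1 : (1 : ℝ) < ((γ 0 0 + γ 1 1 : ℤ) : ℝ) := by push_cast; linarith
    have l2 : ((γ 0 0 + γ 1 1 : ℤ) : ℝ) < 3 := by push_cast; linarith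
    have l1' : 1 < γ 0 0 + γ 1 1 := by exact_mod_cast l1
    have l2' : γ 0 0 + γ 1 1 < 3 := by exact_mod_cast l2
    omega
  have hE01 : δ 0 1 - t * δ 1 1 ≠ 0 := by
    intro h0
    have : |t * δ 1 1| < 1 / 8 := by rw [abs_lt]; constructor <;> linarith
    rw [abs_mul, abs_of_pos (by linarith : 0 < δ 1 1)] at this
    nlinarith
  have hg11 : γ 1 1 = 2 - γ 0 0 := by linarith
  have hg11' : (γ 1 1 : ℝ) = 2 - γ 0 0 := by exact_mod_cast hg11
  rw [hg11] at hdγ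
  have hsq : (γ 0 0 - 1) ^ 2 + γ 0 1 * γ 1 0 = 0 := by linear_combination -hdγ
  have hne : γ 0 1 ≠ 0 ∨ γ 1 0 ≠ 0 := by
    by_contra! hcon
    have ha : γ 0 0 - 1 = 0 := by
      rw [hcon.1, zero_mul, add_zero] at hsq
      exact pow_eq_zero_iff (two_ne_zero) |>.1 hsq
    have ha' : (γ 0 0 : ℝ) = 1 := by exact_mod_cast (by linarith : γ 0 0 = 1)
    rw [hg11', hcon.1, hcon.2, ha'] at h01
    apply hE01
    push_cast at h01
    linear_combination h01
  obtain ⟨k, x, y, hk, hxy, ha, hb, hc⟩ := exists_eq_of_sq_add_mul_eq_zero hsq hne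
  have ha' : (γ 0 0 : ℝ) = 1 - k * x * y := by
    have : γ 0 0 = 1 - k * x * y := by linarith
    exact_mod_cast this
  have hb' : (γ 0 1 : ℝ) = k * x ^ 2 := by exact_mod_cast hb
  have hc' : (γ 1 0 : ℝ) = -(k * y ^ 2) := by exact_mod_cast hc
  rw [hg11', ha', hb', hc'] at h01 h10
  have k01 : δ 0 1 - t * δ 1 1 = k * lat A 0 x y ^ 2 := by
    rw [lat]; linear_combination h01
  have k10 : δ 1 0 = -(k * lat A 1 x y ^ 2) := by
    rw [lat]; linear_combination h10
  have hk1 : (1 : ℝ) ≤ |(k : ℝ)| := by exact_mod_cast Int.one_le_abs hk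
  have hle : ∀ w : ℝ, w ^ 2 ≤ |k * w ^ 2| := fun w => by
    rw [abs_mul, abs_of_nonneg (sq_nonneg w)]
    nlinarith [sq_nonneg w]
  refine ⟨x, y, hxy, (hle _).trans ?_, (hle _).trans ?_⟩
  · rw [← k01]
    calc |δ 0 1 - t * δ 1 1| ≤ |δ 0 1| + |t * δ 1 1| := abs_sub _ _
      _ ≤ 1 / 8 + |t| * (9 / 8) := by
        rw [abs_mul]
        gcongr
        · rw [abs_le]; constructor <;> linarith
        · rw [abs_le]; constructor <;> linarith
      _ ≤ 2 * |t| := by linarith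
  · rw [k10, abs_neg]

namespace IsPastInvariant

variable {e : ℝ} {Y : Set ((ℕ → Bool) × SL2R)}

theorem exists_recurrence (he : 0 < e) (hY : IsPastInvariant e Y) {τ : ℝ} (hτ : 0 < τ) :
    ∃ r b A, τ ≤ |r| ∧ |r| ≤ 400 * τ ∧ (b, A) ∈ Y ∧ (b, unip r * A) ∈ Y := by
  by_contra! hno
  obtain ⟨ε₀, hε₀, hdrift⟩ := hY.exists_shear_le he hτ hno
  obtain ⟨m, hm⟩ := exists_close_pair (isCompact_boundedMat √(2 / e))
    (ε := min ε₀ (1 / 8)) (by positivity)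
  obtain ⟨⟨b, A⟩, hA⟩ := hY.nonempty
  obtain ⟨J, hJ⟩ := pow_unbounded_of_one_lt (32 / e) (by norm_num : (1 : ℝ) < 3)
  obtain ⟨n, hn⟩ := pow_unbounded_of_one_lt
    (9 + 162 * τ * 3 ^ (m + J) / e + 216 * τ * 3 ^ m) (by norm_num : (1 : ℝ) < 3)
  have p1 : 0 < 162 * τ * 3 ^ (m + J) / e := by positivity
  have p2 : 0 < 216 * τ * 3 ^ m := by positivity
  have hn2 : 2 ≤ n := by
    by_contra! hlt
    have : (3 : ℝ) ^ n ≤ 3 ^ 1 := by gcongr; norm_num; omega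
    norm_num at this
    linarith
  let c : ℕ → ℕ → Bool := fun i => Function.update b (n + i) (!b (n + i))
  let σ : ℕ → ℝ := fun i => intSum (n + i + 1) b - intSum (n + i + 1) (c i)
  have hσ : ∀ i, ∃ κ : ℝ, (κ = 1 ∨ κ = -1) ∧ σ i = κ * (2 * 3 ^ (n + i)) := fun i =>
    exists_intSum_sub_update (n + i + 1) (n + i) (by omega) b
  have hpt := fun i => hY.exists_mem_boundedMat he (hY.splice_mem b A hA (n + i + 1) (c i))
  choose g hgB hgY using hpt
  obtain ⟨i, j, him, hji, hδ⟩ := hm _ hgB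
  set B : ℕ → SL2R := fun i => unip (intSum (n + i + 1) b - intSum (n + i + 1) (c i)) * A * intMat (g i)
    with hB
  set δ := B i * (B j)⁻¹ with hδdef
  have hδ' : δ ∈ nearOne (min ε₀ (1 / 8)) := hδ
  have hagree : ∀ i, ∀ l < n, splice (n + i + 1) (c i) b l = b l := fun i l hl => by
    simp only [splice, c]
    rw [if_pos (by omega), Function.update_of_ne (by omega)]
  have hmono : ∀ ε ε', ε ≤ ε' → nearOne ε ⊆ nearOne ε' := fun ε ε' h D hD =>
    ⟨hD.1.trans_le h, hD.2.1.trans_le h, hD.2.2.1.trans_le h, hD.2.2.2.trans_le h⟩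
  have hs := hdrift n _ _ (B j) δ (hgY j) (by
      rw [hδdef, inv_mul_cancel_right]; exact hgY i)
    (fun l hl => by rw [hagree j l hl, hagree i l hl]) (hmono _ _ (min_le_left _ _) hδ')
  obtain ⟨-, -, h10⟩ := coeff_le_of_shear_le hn2 hs
  set t := σ i - σ j with ht
  have hpow : (3 : ℝ) ^ (n + j) * 3 ≤ 3 ^ (n + i) := by
    rw [← pow_succ]; exact pow_le_pow_right₀ (by norm_num) (by omega)
  have hpowj : (3 : ℝ) ^ n ≤ 3 ^ (n + j) := by gcongr; norm_num; omega
  have hpowi : (3 : ℝ) ^ (n + i) ≤ 3 ^ (n + m) := by gcongr; norm_num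
  have htb : 4 ≤ |t| ∧ |t| ≤ 4 * 3 ^ (n + m) := by
    obtain ⟨κ, hκ, h1⟩ := hσ i
    obtain ⟨κ', hκ', h2⟩ := hσ j
    rw [ht, h1, h2, le_abs, abs_le]
    rcases hκ with rfl | rfl <;> rcases hκ' with rfl | rfl
    · exact ⟨.inl (by linarith), by linarith, by linarith⟩
    · exact ⟨.inl (by linarith), by linarith, by linarith⟩
    · exact ⟨.inr (by linarith), by linarith, by linarith⟩
    · exact ⟨.inr (by linarith), by linarith, by linarith⟩
  have h9 : (9 : ℝ) ^ n = 3 ^ n * 3 ^ n := by rw [← mul_pow]; norm_num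
  have htδ : |t * δ 1 0| < 1 / 2 := by
    rw [abs_mul]
    calc _ ≤ 4 * 3 ^ (n + m) * (27 * τ / 9 ^ n) := by gcongr; exact htb.2
      _ = 108 * τ * 3 ^ m / 3 ^ n := by rw [h9, pow_add]; field_simp; norm_num
      _ < 1 / 2 := by rw [div_lt_iff₀ (by positivity)]; linarith
  have hEq : unip (-t) * δ * B j = B j * intMat ((g j)⁻¹ * g i) := by
    rw [mul_assoc, hδdef, inv_mul_cancel_right, map_mul, map_inv]
    simp only [hB]
    rw [show intSum (n + i + 1) b - intSum (n + i + 1) (c i) = σ i from rfl,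
      show intSum (n + j + 1) b - intSum (n + j + 1) (c j) = σ j from rfl]
    have e1 : unip (-t) * unip (σ i) = unip (σ j) := by rw [unip_mul_unip, ht]; congr 1; ring
    rw [← mul_assoc, ← mul_assoc, e1]
    group
  obtain ⟨p, q, hpq, hw0, hw1⟩ := exists_short_of_almost_unip hEq
    (hmono _ _ (min_le_right _ _) hδ') htb.1 htδ
  have hfin := le_of_mem_thickPast (hY.subset (hgY j)) hpq (n + m + J)
  have f0 : 2 * lat (B j) 0 p q ^ 2 / 3 ^ (n + m + J) < e / 2 := by
    calc 2 * lat (B j) 0 p q ^ 2 / 3 ^ (n + m + J)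
      _ ≤ 2 * (2 * (4 * 3 ^ (n + m))) / 3 ^ (n + m + J) := by gcongr; exact hw0.trans (by linarith [htb.2])
      _ = 16 / 3 ^ J := by rw [pow_add _ (n + m) J]; field_simp; norm_num
      _ < e / 2 := by
        rw [div_lt_iff₀ he] at hJ
        rw [div_lt_iff₀ (by positivity)]; linarith
  have f1 : 3 * 3 ^ (n + m + J) * lat (B j) 1 p q ^ 2 < e / 2 := by
    calc _ ≤ 3 * 3 ^ (n + m + J) * (27 * τ / 9 ^ n) := by gcongr; exact hw1.trans h10
      _ = 81 * τ * 3 ^ (m + J) / 3 ^ n := by rw [h9, pow_add, pow_add, pow_add]; field_simp; norm_num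
      _ < e / 2 := by
        have : 162 * τ * 3 ^ (m + J) / e < 3 ^ n := by linarith
        rw [div_lt_iff₀ he] at this
        rw [div_lt_iff₀ (by positivity)]; linarith
  have hfin' : e ≤ 2 * lat (B j) 0 p q ^ 2 / 3 ^ (n + m + J) +
    3 * 3 ^ (n + m + J) * lat (B j) 1 p q ^ 2 := hfin
  linarith

end IsPastInvariant

theorem exists_walk_notMem_thick {e : ℝ} (he : 0 < e) (A : SL2R) : ∃ w, walk w A ∉ thick e := by
  by_contra! hA
  have hY := isPastInvariant_thickPast (thickPast_nonempty he hA)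
  obtain ⟨Z, hZ⟩ := hY.exists_minimal he
  exact hZ.prop.not_unip_invariant he
    (IsPastInvariant.unip_invariant_of_recurrent hZ fun τ hτ => hZ.prop.exists_recurrence he hτ)

/-! ### From short vectors to prescribed coefficients -/

/-- The signed horizontal deviation of a lattice vector from the line of slope `1 / y`. -/
def dev (A : SL2R) (y : ℝ) (p q : ℤ) : ℝ := y * lat A 1 p q - lat A 0 p q

/-- Pairs `(A, y)` for which the lattice of `A` provides an approximation of `y` whose continued
fraction tail lies in `J`. -/
def hitSet (J : Set ℝ) : Set (SL2R × ℝ) :=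
  {z | ∃ σ p q p' q' k : ℤ, (σ = 1 ∨ σ = -1) ∧ p * q' - p' * q = -σ ∧ 0 < lat z.1 1 p q ∧
    0 < σ * dev z.1 z.2 p q ∧ lat z.1 1 p q * |dev z.1 z.2 p q| < 1 / 3 ∧
    -dev z.1 z.2 p' q' / dev z.1 z.2 p q - k ∈ J}

/-- Prepend a finite word to a binary sequence. -/
def appendWord : List Bool → (ℕ → Bool) → ℕ → Bool
  | [], b, n => b n
  | d :: _, _, 0 => d
  | _ :: w, b, n + 1 => appendWord w b n

theorem cantorPoint_appendWord_cons (d : Bool) (w : List Bool) (b : ℕ → Bool) :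
    cantorPoint (appendWord (d :: w) b) = (cantorPoint (appendWord w b) + cantorDigit d) / 3 := by
  rw [cantorPoint_eq_trunc_add 1]
  simp only [cantorTrunc, Finset.sum_range_one, appendWord]
  rw [show (fun i => appendWord w b i) = appendWord w b from rfl]
  ring

theorem continuous_dev (p q : ℤ) : Continuous fun z : SL2R × ℝ => dev z.1 z.2 p q :=
  (continuous_snd.mul ((continuous_lat 1 p q).comp continuous_fst)).sub
    ((continuous_lat 0 p q).comp continuous_fst)

theorem isOpen_hitSet {J : Set ℝ} (hJ : IsOpen J) : IsOpen (hitSet J) := by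
  rw [isOpen_iff_mem_nhds]
  rintro z ⟨σ, p, q, p', q', k, hσ, hdet, h1, h2, h3, h4⟩
  have hc := continuous_dev p q
  have hl : Continuous fun z : SL2R × ℝ => lat z.1 1 p q := (continuous_lat 1 p q).comp continuous_fst
  have hne : dev z.1 z.2 p q ≠ 0 := right_ne_zero_of_mul h2.ne'
  have c4 : ContinuousAt (fun z : SL2R × ℝ => -dev z.1 z.2 p' q' / dev z.1 z.2 p q - k) z :=
    ((continuous_dev p' q').neg.continuousAt.div hc.continuousAt hne).sub continuousAt_const
  filter_upwards [(isOpen_lt continuous_const hl).mem_nhds h1,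
    (isOpen_lt continuous_const (continuous_const.mul hc)).mem_nhds h2,
    (isOpen_lt (hl.mul hc.abs) continuous_const).mem_nhds h3,
    c4.preimage_mem_nhds (hJ.mem_nhds h4)] with x x1 x2 x3 x4
  exact ⟨σ, p, q, p', q', k, hσ, hdet, x1, x2, x3, x4⟩

theorem mem_hitSet_of_mul_intMat {J : Set ℝ} {A : SL2R} {y : ℝ} {γ : SL2Z}
    (h : (A * intMat γ, y) ∈ hitSet J) : (A, y) ∈ hitSet J := by
  obtain ⟨σ, p, q, p', q', k, hσ, hdet, h⟩ := h
  simp only [dev, lat_mul_intMat] at h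
  refine ⟨σ, _, _, _, _, k, hσ, ?_, h⟩
  linear_combination hdet + (p * q' - p' * q) * SL2Z_det γ

theorem dev_walkStep (d : Bool) (A : SL2R) (y : ℝ) (p q : ℤ) :
    dev (walkStep d A) y p q = √3 * dev A ((y + cantorDigit d) / 3) p q := by
  have h3 : √3 * √3 = 3 := Real.mul_self_sqrt (by norm_num)
  have h3' : (√3)⁻¹ = √3 / 3 := by field_simp; rw [sq, h3]
  rw [dev, dev, walkStep, mul_assoc, lat_unip_zero, lat_unip_one, lat_diag3_zero, lat_diag3_one, h3']
  ring

theorem lat_one_walkStep (d : Bool) (A : SL2R) (p q : ℤ) :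
    lat (walkStep d A) 1 p q = (√3)⁻¹ * lat A 1 p q := by
  rw [walkStep, mul_assoc, lat_unip_one, lat_diag3_one]

theorem mem_hitSet_of_walkStep {J : Set ℝ} {d : Bool} {A : SL2R} {y : ℝ}
    (h : (walkStep d A, y) ∈ hitSet J) : (A, (y + cantorDigit d) / 3) ∈ hitSet J := by
  obtain ⟨σ, p, q, p', q', k, hσ, hdet, h1, h2, h3, h4⟩ := h
  simp only [dev_walkStep, lat_one_walkStep] at h1 h2 h3 h4
  have hs : 0 < √3 := by positivity
  refine ⟨σ, p, q, p', q', k, hσ, hdet, ?_, ?_, ?_, ?_⟩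
  · exact (mul_pos_iff_of_pos_left (by positivity)).1 h1
  · rw [mul_left_comm] at h2
    exact (mul_pos_iff_of_pos_left hs).1 h2
  · rw [abs_mul, abs_of_pos hs] at h3
    convert h3 using 1
    field_simp
  · rwa [← mul_neg, mul_div_mul_left _ _ hs.ne'] at h4

theorem mem_hitSet_of_walk {J : Set ℝ} {b : ℕ → Bool} : ∀ (w : List Bool) (A : SL2R),
    (walk w A, cantorPoint b) ∈ hitSet J → (A, cantorPoint (appendWord w b)) ∈ hitSet J
  | [], _, h => by
    rwa [show appendWord [] b = b from funext fun n => by rw [appendWord]]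
  | d :: w, A, h => by
    rw [cantorPoint_appendWord_cons]
    exact mem_hitSet_of_walkStep (mem_hitSet_of_walk w _ h)

theorem exists_pattern_of_mem_hitSet {x : ℝ} (hx : Irrational x) (hx0 : 0 < x) (hx1 : x < 1)
    {l : List ℕ} (h : ((1 : SL2R), x) ∈ hitSet (cfCylinder l)) :
    ∃ m, ∀ (i : ℕ) (hi : i < l.length), cfCoeff x (m + i + 1) = (l[i] : ℤ) := by
  obtain ⟨σ, p, q, p', q', k, hσ, hdet, h1, h2, h3, h4⟩ := h
  have e0 : ∀ p q : ℤ, lat 1 0 p q = p := fun p q => by simp [lat]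
  have e1 : ∀ p q : ℤ, lat 1 1 p q = q := fun p q => by simp [lat]
  simp only [dev, e0, e1] at h1 h2 h3 h4
  refine exists_pattern_of_approx hx hx0 hx1 hσ hdet (by exact_mod_cast h1)
    (z := k) (by rwa [mul_comm (q : ℝ)]) (by rwa [mul_comm (q : ℝ) x]) ?_
  convert h4 using 3
  · ring
  · ring

theorem notMem_thick {e : ℝ} {A : SL2R} (h : A ∉ thick e) :
    ∃ p q : ℤ, IsCoprime p q ∧ lat A 0 p q ^ 2 + lat A 1 p q ^ 2 < e := by
  simp only [thick, Set.mem_ofPred_eq, not_forall, not_le] at h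
  obtain ⟨p, q, hpq, h⟩ := h
  have hg : 0 < Int.gcd p q := Int.gcd_pos_iff.2 hpq
  obtain ⟨g, x, y, hg0, hco, rfl, rfl⟩ := Int.exists_gcd_one' hg
  refine ⟨x, y, Int.isCoprime_iff_gcd_eq_one.2 hco, lt_of_le_of_lt ?_ h⟩
  have hl : ∀ i, lat A i (x * g) (y * g) = lat A i x y * g := fun i => by
    simp only [lat]; push_cast; ring
  have hg1 : (1 : ℝ) ≤ (g : ℝ) ^ 2 := one_le_pow₀ (by exact_mod_cast hg0)
  rw [hl, hl, mul_pow, mul_pow, ← add_mul]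
  exact le_mul_of_one_le_right (by positivity) hg1

theorem lat_det (A : SL2R) (p q p' q' : ℤ) :
    lat A 0 p q * lat A 1 p' q' - lat A 1 p q * lat A 0 p' q' = p * q' - p' * q := by
  simp only [lat]
  linear_combination ((p : ℝ) * q' - p' * q) * SL2R_det A

/-- If the walk exits the thick part, some point of the Cantor set hits. -/
theorem exists_mem_hitSet_of_exit {J : Set ℝ} {e : ℝ} (he40 : e ≤ 1 / 40)
    (hL : ∀ L ≥ 1 / e, ∀ y₀ : ℝ, |y₀| ≤ 10 → ∀ κ : ℤ → ℝ,
      ∃ σ : ℤ, (σ = 1 ∨ σ = -1) ∧ ∃ a : ℕ → Bool, 1 / 6 ≤ σ * (cantorPoint a - y₀) ∧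
        ∃ z : ℤ, σ * L / (cantorPoint a - y₀) + κ σ - z ∈ J)
    {A : SL2R} {d : Bool} (hA : A ∈ thick e) (hA' : walkStep d A ∉ thick e) :
    ∃ a, (walkStep d A, cantorPoint a) ∈ hitSet J := by
  obtain ⟨p, q, hco, hlt⟩ := notMem_thick hA'
  have hne : ∀ {p q : ℤ}, IsCoprime p q → p ≠ 0 ∨ q ≠ 0 := fun h => by
    by_contra! h'
    rw [h'.1, h'.2] at h
    exact not_isCoprime_zero_zero h
  have hthick := hA p q (hne hco)
  set B := walkStep d A with hB
  have h0 : lat B 0 p q = √3 * lat A 0 p q - cantorDigit d * lat B 1 p q := by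
    rw [hB, lat_one_walkStep, walkStep, mul_assoc, lat_unip_zero, lat_diag3_zero, lat_diag3_one]; ring
  have h1 : lat A 1 p q = √3 * lat B 1 p q := by
    rw [hB, lat_one_walkStep]; field_simp
  have h3 : √3 * √3 = 3 := Real.mul_self_sqrt (by norm_num)
  have hv2 : e < 15 * lat B 1 p q ^ 2 := by
    have ha : 3 * lat A 0 p q ^ 2 = (lat B 0 p q + cantorDigit d * lat B 1 p q) ^ 2 := by
      rw [h0]; linear_combination (-lat A 0 p q ^ 2) * h3
    have hb : lat A 1 p q ^ 2 = 3 * lat B 1 p q ^ 2 := by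
      rw [h1]; linear_combination (lat B 1 p q ^ 2) * h3
    have hd1 := cantorDigit_nonneg d
    have hd2 := cantorDigit_le_two d
    have hd3 : (cantorDigit d * lat B 1 p q) ^ 2 ≤ 4 * lat B 1 p q ^ 2 := by
      rw [mul_pow]; gcongr; nlinarith
    nlinarith [sq_nonneg (lat B 0 p q - cantorDigit d * lat B 1 p q)]
  clear h0 h1 hthick
  obtain ⟨p, q, hco, hlt, hv2, hpos⟩ : ∃ p q : ℤ, IsCoprime p q ∧
      lat B 0 p q ^ 2 + lat B 1 p q ^ 2 < e ∧ e < 15 * lat B 1 p q ^ 2 ∧ 0 < lat B 1 p q := by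
    have hn : ∀ i, lat B i (-p) (-q) = -lat B i p q := fun i => by
      simp only [lat]; push_cast; ring
    rcases lt_trichotomy (lat B 1 p q) 0 with h | h | h
    · exact ⟨-p, -q, hco.neg_neg, by simpa [hn] using hlt, by simpa [hn] using hv2,
        by rw [hn]; linarith⟩
    · rw [h] at hlt hv2
      nlinarith [sq_nonneg (lat B 0 p q)]
    · exact ⟨p, q, hco, hlt, hv2, h⟩
  obtain ⟨s, t, hst⟩ := hco
  set v1 := lat B 0 p q with hv1
  set v2 := lat B 1 p q with hv2'
  have hy0 : |v1 / v2| ≤ 10 := by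
    rw [abs_div, abs_of_pos hpos, div_le_iff₀ hpos]
    refine abs_le_of_sq_le_sq ?_ (by positivity)
    nlinarith
  have hLv : 1 / v2 ^ 2 ≥ 1 / e := by
    apply one_div_le_one_div_of_le (by positivity)
    nlinarith [sq_nonneg v1]
  obtain ⟨σ, hσ, a, ha, z, hz⟩ := hL _ hLv _ hy0 fun σ => -(σ * lat B 1 t (-s)) / v2
  set y := cantorPoint a with hy
  have hdev : dev B y p q = v2 * (y - v1 / v2) := by
    rw [dev, ← hv1, ← hv2']; field_simp
  have hyne : y - v1 / v2 ≠ 0 := by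
    rintro h0; rw [h0] at ha; norm_num at ha
  refine ⟨a, σ, p, q, σ * t, σ * -s, z, hσ, ?_, hpos, ?_, ?_, ?_⟩
  · linear_combination (-σ) * hst
  · rw [hdev, mul_left_comm]
    exact mul_pos hpos (by linarith)
  · rw [hdev, abs_mul, abs_of_pos hpos, ← mul_assoc]
    have hya : |y - v1 / v2| ≤ 11 := by
      rw [abs_le] at hy0 ⊢
      constructor <;> linarith [cantorPoint_nonneg a, cantorPoint_le_one a]
    have : v2 * v2 ≤ 1 / 40 := by nlinarith [sq_nonneg v1]
    calc v2 * v2 * |y - v1 / v2| ≤ 1 / 40 * 11 := by gcongr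
      _ < 1 / 3 := by norm_num
  · convert hz using 2
    have hl : ∀ i, lat B i (σ * t) (σ * -s) = σ * lat B i t (-s) := fun i => by
      simp only [lat]; push_cast; ring
    have hdet := lat_det B p q t (-s)
    rw [← hv1, ← hv2'] at hdet
    have hst' : (s : ℝ) * p + t * q = 1 := by exact_mod_cast hst
    have hw : lat B 0 t (-s) = (v1 * lat B 1 t (-s) + 1) / v2 := by
      rw [eq_div_iff hpos.ne']
      push_cast at hdet
      linear_combination -hdet + hst'
    have hD : y * v2 - v1 ≠ 0 := by
      have := mul_ne_zero hpos.ne' hyne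
      rwa [mul_sub, mul_div_cancel₀ _ hpos.ne', mul_comm] at this
    rw [hdev, dev, hl, hl, hw]
    change -(y * _ - _) / _ = _
    field_simp
    ring

theorem exists_mem_hitSet_of_walk {J : Set ℝ} {e : ℝ} (he40 : e ≤ 1 / 40)
    (hL : ∀ L ≥ 1 / e, ∀ y₀ : ℝ, |y₀| ≤ 10 → ∀ κ : ℤ → ℝ,
      ∃ σ : ℤ, (σ = 1 ∨ σ = -1) ∧ ∃ a : ℕ → Bool, 1 / 6 ≤ σ * (cantorPoint a - y₀) ∧
        ∃ z : ℤ, σ * L / (cantorPoint a - y₀) + κ σ - z ∈ J) :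
    ∀ (w : List Bool) {A : SL2R}, A ∈ thick e → walk w A ∉ thick e →
      ∃ a, (A, cantorPoint a) ∈ hitSet J
  | [], _, hA, hw => absurd hA hw
  | d :: w, A, hA, hw => by
    by_cases h : walkStep d A ∈ thick e
    · obtain ⟨a, ha⟩ := exists_mem_hitSet_of_walk he40 hL w h hw
      exact ⟨appendWord [d] a, mem_hitSet_of_walk [d] A ha⟩
    · obtain ⟨a, ha⟩ := exists_mem_hitSet_of_exit he40 hL hA h
      exact ⟨appendWord [d] a, mem_hitSet_of_walk [d] A ha⟩

theorem abs_cantorPoint_sub_le {n : ℕ} {a b : ℕ → Bool} (h : ∀ i < n, b i = a i) :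
    |cantorPoint b - cantorPoint a| ≤ 1 / 3 ^ n := by
  rw [cantorPoint_eq_trunc_add n b, cantorPoint_eq_trunc_add n a, cantorTrunc_congr h,
    add_sub_add_left_eq_sub, ← sub_div, abs_div, abs_of_pos (by positivity : (0 : ℝ) < 3 ^ n)]
  gcongr
  rw [abs_le]
  constructor <;> linarith [cantorPoint_nonneg fun i => a (i + n), cantorPoint_le_one fun i => a (i + n),
    cantorPoint_nonneg fun i => b (i + n), cantorPoint_le_one fun i => b (i + n)]

/-- From any thick lattice, some cylinder of bounded length hits. -/
theorem exists_uniform_hit {J : Set ℝ} (hJ : IsOpen J) (hJne : J.Nonempty) :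
    ∃ e : ℝ, 0 < e ∧ e ≤ 1 / 40 ∧ ∃ L : ℕ, ∀ A ∈ thick e, ∃ a : ℕ → Bool, ∀ b : ℕ → Bool,
      (∀ i < L, b i = a i) → (A, cantorPoint b) ∈ hitSet J := by
  obtain ⟨L₀, hL₀⟩ := exists_cantorPoint_div_mem hJ hJne
  set e : ℝ := min (1 / 40) (1 / (|L₀| + 1)) with he
  have he0 : 0 < e := by positivity
  have he40 : e ≤ 1 / 40 := min_le_left _ _
  have heL : L₀ ≤ 1 / e := by
    have : 1 / (1 / (|L₀| + 1)) ≤ 1 / e := one_div_le_one_div_of_le he0 (min_le_right _ _)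
    rw [one_div_one_div] at this
    linarith [le_abs_self L₀]
  have hT : ∀ A ∈ thick e, ∃ a, (A, cantorPoint a) ∈ hitSet J := fun A hA => by
    obtain ⟨w, hw⟩ := exists_walk_notMem_thick he0 A
    exact exists_mem_hitSet_of_walk he40 (fun L hL => hL₀ L (heL.trans hL)) w hA hw
  have hK : IsCompact (boundedMat √(2 / e) ∩ thick e) :=
    (isCompact_boundedMat _).inter_right (isClosed_thick e)
  have key : ∃ L : ℕ, ∀ A ∈ boundedMat √(2 / e) ∩ thick e, ∃ a : ℕ → Bool, ∀ b : ℕ → Bool,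
      (∀ i < L, b i = a i) → (A, cantorPoint b) ∈ hitSet J := by
    refine hK.induction_on (p := fun s => ∃ L : ℕ, ∀ A ∈ s, ∃ a : ℕ → Bool, ∀ b : ℕ → Bool,
      (∀ i < L, b i = a i) → (A, cantorPoint b) ∈ hitSet J) ⟨0, by simp⟩ ?_ ?_ ?_
    · rintro s t hst ⟨L, h⟩
      exact ⟨L, fun A hA => h A (hst hA)⟩
    · rintro s t ⟨L, h⟩ ⟨L', h'⟩
      refine ⟨max L L', fun A hA => ?_⟩
      rcases hA with hA | hA
      · obtain ⟨a, ha⟩ := h A hA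
        exact ⟨a, fun b hb => ha b fun i hi => hb i (lt_max_of_lt_left hi)⟩
      · obtain ⟨a, ha⟩ := h' A hA
        exact ⟨a, fun b hb => ha b fun i hi => hb i (lt_max_of_lt_right hi)⟩
    · intro A hA
      obtain ⟨a, ha⟩ := hT A hA.2
      obtain ⟨U, V, hU, hAU, hV, haV, hUV⟩ := mem_nhds_prod_iff'.1 ((isOpen_hitSet hJ).mem_nhds ha)
      obtain ⟨ε, hε, hball⟩ := Metric.isOpen_iff.1 hV _ haV
      obtain ⟨L, hL⟩ := exists_pow_lt_of_lt_one hε (by norm_num : (1 / 3 : ℝ) < 1)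
      refine ⟨U, mem_nhdsWithin_of_mem_nhds (hU.mem_nhds hAU), L, fun A' hA' => ⟨a, fun b hb => ?_⟩⟩
      refine hUV (Set.mk_mem_prod hA' (hball ?_))
      rw [Metric.mem_ball, Real.dist_eq]
      refine (abs_cantorPoint_sub_le hb).trans_lt ?_
      rwa [one_div_pow] at hL
  obtain ⟨L, hL⟩ := key
  refine ⟨e, he0, he40, L, fun A hA => ?_⟩
  obtain ⟨γ, hγ⟩ := exists_mul_intMat_mem_boundedMat he0 hA
  obtain ⟨a, ha⟩ := hL _ ⟨hγ, mul_intMat_mem_thick hA γ⟩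
  exact ⟨a, fun b hb => mem_hitSet_of_mul_intMat (ha b hb)⟩

/-! ### Return to the thick part -/

theorem eq_or_eq_neg_of_isCoprime_of_det_eq_zero {p q p' q' : ℤ} (h : IsCoprime p q)
    (h' : IsCoprime p' q') (hdet : p * q' - p' * q = 0) :
    (p' = p ∧ q' = q) ∨ (p' = -p ∧ q' = -q) := by
  obtain ⟨s, t, hst⟩ := h
  obtain ⟨u, v, huv⟩ := h'
  have hp : p' = (s * p' + t * q') * p := by linear_combination -p' * hst - t * hdet
  have hq : q' = (s * p' + t * q') * q := by linear_combination -q' * hst + s * hdet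
  have hu : IsUnit (s * p' + t * q') := by
    refine IsUnit.of_mul_eq_one (u * p + v * q) ?_
    linear_combination huv - u * hp - v * hq
  rcases Int.isUnit_iff.1 hu with h1 | h1
  · rw [h1] at hp hq
    exact Or.inl ⟨by linarith, by linarith⟩
  · rw [h1] at hp hq
    exact Or.inr ⟨by linarith, by linarith⟩

theorem cantorPoint_eq_shift (a : ℕ → Bool) :
    cantorPoint a = (cantorPoint (fun i => a (i + 1)) + cantorDigit (a 0)) / 3 := by
  rw [cantorPoint_eq_trunc_add 1]
  simp only [cantorTrunc, Finset.sum_range_one]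
  ring

theorem pow_mul_abs_dev_lt_one {e : ℝ} (he : e ≤ 1 / 40) : ∀ (n : ℕ) (A : SL2R) (a : ℕ → Bool),
    (∀ k, walk (List.ofFn fun i : Fin k => a i) A ∉ thick e) → ∀ p q, IsCoprime p q →
    lat A 0 p q ^ 2 + lat A 1 p q ^ 2 < e → √3 ^ n * |dev A (cantorPoint a) p q| < 1
  | 0, A, a, _, p, q, _, h => by
    have h0 := cantorPoint_nonneg a
    have h1 := cantorPoint_le_one a
    have h2 : |lat A 1 p q| < 1 / 2 := abs_lt_of_sq_lt_sq (by nlinarith) (by norm_num)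
    have h3 : |lat A 0 p q| < 1 / 2 := abs_lt_of_sq_lt_sq (by nlinarith) (by norm_num)
    have h4 : |cantorPoint a * lat A 1 p q| ≤ |lat A 1 p q| := by
      rw [abs_mul, abs_of_nonneg h0]
      exact mul_le_of_le_one_left (abs_nonneg _) h1
    rw [pow_zero, one_mul, dev]
    linarith [abs_sub (cantorPoint a * lat A 1 p q) (lat A 0 p q)]
  | n + 1, A, a, hA, p, q, hpq, h => by
    have hA' : ∀ k, walk (List.ofFn fun i : Fin k => a (i + 1)) (walkStep (a 0) A) ∉ thick e := by
      intro k
      simpa [List.ofFn_succ, walk] using hA (k + 1)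
    obtain ⟨p', q', hpq', h'⟩ := notMem_thick (by simpa [walk] using hA' 0)
    have ih := pow_mul_abs_dev_lt_one he n _ (fun i => a (i + 1)) hA' p' q' hpq' h'
    have h3 : √3 * √3 = 3 := Real.mul_self_sqrt (by norm_num)
    have h3' : (√3)⁻¹ = √3 / 3 := by field_simp; rw [sq, h3]
    have hsize : lat (walkStep (a 0) A) 0 p q ^ 2 + lat (walkStep (a 0) A) 1 p q ^ 2 ≤ 6 * e := by
      rw [walkStep, mul_assoc, lat_unip_zero, lat_unip_one, lat_diag3_zero, lat_diag3_one, h3']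
      set x := lat A 0 p q
      set y := lat A 1 p q
      cases a 0
      · simp only [cantorDigit]
        norm_num [mul_pow]
        nlinarith [sq_nonneg x, sq_nonneg y]
      · simp only [cantorDigit, if_true]
        have : (√3 * x + -2 * (√3 / 3 * y)) ^ 2 + (√3 / 3 * y) ^ 2
            = 3 * x ^ 2 - 4 * x * y + 5 / 3 * y ^ 2 := by
          linear_combination (x ^ 2 - 4 / 3 * x * y + 5 / 9 * y ^ 2) * h3
        rw [this]
        nlinarith [sq_nonneg (x + y), sq_nonneg x, sq_nonneg y]
    have hdet : p * q' - p' * q = 0 := by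
      have h1 := lat_det (walkStep (a 0) A) p q p' q'
      generalize lat (walkStep (a 0) A) 0 p q = x at *
      generalize lat (walkStep (a 0) A) 1 p q = y at *
      generalize lat (walkStep (a 0) A) 0 p' q' = x' at *
      generalize lat (walkStep (a 0) A) 1 p' q' = y' at *
      have h2 : ((p * q' - p' * q : ℤ) : ℝ) ^ 2 < 1 := by
        push_cast
        rw [← h1]
        have h3 : (x ^ 2 + y ^ 2) * (x' ^ 2 + y' ^ 2) ≤ 6 * e * e :=
          mul_le_mul hsize h'.le (by positivity) (le_trans (by positivity) hsize)
        have he0 : 0 ≤ e := le_trans (by positivity) h'.le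
        nlinarith [sq_nonneg (x * x' + y * y')]
      have h3 : (p * q' - p' * q) ^ 2 < 1 := by exact_mod_cast h2
      exact Int.abs_lt_one_iff.1 (sq_lt_one_iff_abs_lt_one _ |>.1 h3)
    have habs : |dev (walkStep (a 0) A) (cantorPoint fun i => a (i + 1)) p' q'|
        = √3 * |dev A (cantorPoint a) p q| := by
      rw [dev_walkStep, ← cantorPoint_eq_shift, abs_mul, abs_of_nonneg (Real.sqrt_nonneg 3)]
      rcases eq_or_eq_neg_of_isCoprime_of_det_eq_zero hpq hpq' hdet with ⟨rfl, rfl⟩ | ⟨rfl, rfl⟩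
      · rfl
      · rw [← abs_neg (dev A _ p q)]
        congr 2
        simp only [dev, lat]
        push_cast
        ring
    rw [habs] at ih
    rwa [pow_succ, mul_assoc]

/-- A walk driven by the digits of a point that is irrational relative to the lattice returns to the
thick part. -/
theorem exists_walk_mem_thick {e : ℝ} (he : e ≤ 1 / 40) (A : SL2R) (a : ℕ → Bool)
    (h : ∀ p q : ℤ, IsCoprime p q → dev A (cantorPoint a) p q ≠ 0) :
    ∃ n, walk (List.ofFn fun i : Fin n => a i) A ∈ thick e := by
  by_contra! hA
  obtain ⟨p, q, hpq, hs⟩ := notMem_thick (by simpa [walk] using hA 0)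
  have h0 := abs_pos.2 (h p q hpq)
  have h1 : (1 : ℝ) < √3 := Real.lt_sqrt_of_sq_lt (by norm_num)
  obtain ⟨n, hn⟩ := pow_unbounded_of_one_lt (|dev A (cantorPoint a) p q|)⁻¹ h1
  have h2 := pow_mul_abs_dev_lt_one he n A a hA p q hpq hs
  rw [inv_lt_iff_one_lt_mul₀ h0] at hn
  linarith

/-! ### Cylinders of the Cantor set -/

theorem appendWord_append (w c : List Bool) (a : ℕ → Bool) :
    appendWord (w ++ c) a = appendWord w (appendWord c a) := by
  induction w with
  | nil => funext n; simp [appendWord]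
  | cons d w ih =>
    funext n
    cases n with
    | zero => rfl
    | succ n => exact congrFun ih n

theorem appendWord_ofFn (n : ℕ) (a : ℕ → Bool) :
    appendWord (List.ofFn fun i : Fin n => a i) (fun i => a (i + n)) = a := by
  induction n generalizing a with
  | zero => funext k; simp [appendWord]
  | succ n ih =>
    funext k
    rw [List.ofFn_succ]
    cases k with
    | zero => rfl
    | succ k => exact congrFun (ih fun i => a (i + 1)) k

theorem appendWord_ofFn_apply {n : ℕ} (c : Fin n → Bool) (a : ℕ → Bool) (i : Fin n) :
    appendWord (List.ofFn c) a i = c i := by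
  induction n with
  | zero => exact i.elim0
  | succ n ih =>
    rw [List.ofFn_succ]
    refine Fin.cases rfl (fun i => ?_) i
    exact ih (fun i => c i.succ) i

theorem walk_append (w c : List Bool) (A : SL2R) : walk (w ++ c) A = walk c (walk w A) := by
  induction w generalizing A with
  | nil => rfl
  | cons d w ih => exact ih _

theorem dev_walk (w : List Bool) (A : SL2R) (a : ℕ → Bool) (p q : ℤ) :
    dev (walk w A) (cantorPoint a) p q = √3 ^ w.length * dev A (cantorPoint (appendWord w a)) p q := by
  induction w generalizing A with
  | nil => simp [walk, show appendWord [] a = a from funext fun n => by simp [appendWord]]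
  | cons d w ih =>
    rw [walk, ih, dev_walkStep, ← cantorPoint_appendWord_cons, List.length_cons, pow_succ, mul_assoc]

theorem abs_cantorPoint_appendWord_sub_le (w : List Bool) (a b : ℕ → Bool) :
    |cantorPoint (appendWord w a) - cantorPoint (appendWord w b)| ≤ 1 / 3 ^ w.length := by
  induction w with
  | nil =>
    rw [List.length_nil, pow_zero, div_one, abs_le]
    constructor <;> linarith [cantorPoint_nonneg (appendWord [] a), cantorPoint_le_one (appendWord [] a),
      cantorPoint_nonneg (appendWord [] b), cantorPoint_le_one (appendWord [] b)]
  | cons d w ih =>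
    rw [cantorPoint_appendWord_cons, cantorPoint_appendWord_cons, ← sub_div,
      add_sub_add_right_eq_sub, abs_div, abs_of_pos (by norm_num : (0 : ℝ) < 3), List.length_cons,
      pow_succ, ← div_div]
    gcongr

/-! ### Porous subsets of the Cantor set are null -/

open scoped ENNReal in
theorem hausdorffMeasure_range_appendWord_le (w : List Bool) :
    (Measure.hausdorffMeasure (Real.log 2 / Real.log 3) : Measure ℝ)
      (Set.range fun a => cantorPoint (appendWord w a)) ≤ (2 : ℝ≥0∞)⁻¹ ^ w.length := by
  have hd : 0 < Real.log 2 / Real.log 3 :=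
    div_pos (Real.log_pos (by norm_num)) (Real.log_pos (by norm_num))
  have h32 : (3 : ℝ) ^ (Real.log 2 / Real.log 3) = 2 := by
    rw [Real.log_div_log, Real.rpow_logb (by norm_num) (by norm_num) (by norm_num)]
  let t : ∀ n : ℕ, (Fin n → Bool) → Set ℝ := fun n c =>
    Set.range fun a => cantorPoint (appendWord (w ++ List.ofFn c) a)
  have hdiam : ∀ n c, Metric.ediam (t n c) ≤ ENNReal.ofReal (1 / 3 ^ (w.length + n)) := by
    intro n c
    refine Metric.ediam_le ?_
    rintro _ ⟨a, rfl⟩ _ ⟨b, rfl⟩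
    rw [edist_dist, Real.dist_eq]
    refine ENNReal.ofReal_le_ofReal ?_
    simpa using abs_cantorPoint_appendWord_sub_le (w ++ List.ofFn c) a b
  have hpow : ∀ m : ℕ, ENNReal.ofReal (1 / 3 ^ m) ^ (Real.log 2 / Real.log 3) = 2⁻¹ ^ m := by
    intro m
    rw [ENNReal.ofReal_rpow_of_nonneg (by positivity) hd.le, Real.div_rpow (by norm_num)
      (by positivity), Real.one_rpow, ← Real.rpow_natCast, ← Real.rpow_mul (by norm_num), mul_comm,
      Real.rpow_mul (by norm_num), h32, Real.rpow_natCast, one_div, ← inv_pow,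
      ENNReal.ofReal_pow (by norm_num), ENNReal.ofReal_inv_of_pos (by norm_num), ENNReal.ofReal_ofNat]
  have hr : Filter.Tendsto (fun n : ℕ => ENNReal.ofReal (1 / 3 ^ (w.length + n))) Filter.atTop
      (nhds 0) := by
    rw [← ENNReal.ofReal_zero]
    refine (ENNReal.continuous_ofReal.tendsto 0).comp ?_
    have h := (tendsto_pow_atTop_nhds_zero_of_lt_one (r := (1 / 3 : ℝ)) (by norm_num)
      (by norm_num)).comp (Filter.tendsto_add_atTop_nat w.length)
    refine h.congr fun n => ?_
    rw [Function.comp_apply, one_div_pow, add_comm]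
  refine (Measure.hausdorffMeasure_le_liminf_sum _ _ _ hr t
    (Filter.Eventually.of_forall fun n c => hdiam n c) (Filter.Eventually.of_forall fun n => ?_)).trans ?_
  · rintro _ ⟨a, rfl⟩
    refine Set.mem_iUnion.2 ⟨fun i => a i, fun i => a (i + n), ?_⟩
    simp only [appendWord_append, appendWord_ofFn]
  · refine Filter.liminf_le_of_le (by isBoundedDefault) fun b hb => ?_
    obtain ⟨n, hn⟩ := hb.exists
    refine hn.trans ((Finset.sum_le_sum fun c _ =>
      (ENNReal.rpow_le_rpow (hdiam n c) hd.le).trans_eq (hpow _)).trans_eq ?_)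
    rw [Finset.sum_const, Finset.card_univ, Fintype.card_fun, Fintype.card_bool, Fintype.card_fin,
      nsmul_eq_mul, pow_add, mul_left_comm, Nat.cast_pow, Nat.cast_ofNat, ← mul_pow,
      ENNReal.mul_inv_cancel (by norm_num) (by norm_num), one_pow, mul_one]

/-- A subset of the Cantor set is null if every orbit of digits meets infinitely often a good word
after which a whole subcylinder of fixed depth avoids the set. -/
theorem hausdorffMeasure_inter_range_cantorPoint_eq_zero {E : Set ℝ} {G : List Bool → Prop} {L : ℕ}
    (hG : ∀ w, G w → ∃ c : Fin L → Bool, ∀ a, cantorPoint (appendWord (w ++ List.ofFn c) a) ∉ E)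
    (hret : ∀ w a, cantorPoint (appendWord w a) ∈ E →
      ∃ n, G (w ++ List.ofFn fun i : Fin n => a i)) :
    (Measure.hausdorffMeasure (Real.log 2 / Real.log 3) : Measure ℝ)
      (E ∩ Set.range cantorPoint) = 0 := by
  classical
  set μ : Measure ℝ := Measure.hausdorffMeasure (Real.log 2 / Real.log 3)
  let D : List Bool → Set ℝ := fun w => E ∩ Set.range fun a => cantorPoint (appendWord w a)
  set θ : ENNReal := ((2 ^ L - 1 : ℕ) : ENNReal) * 2⁻¹ ^ L with hθ
  have h2 : (2 : ENNReal) * 2⁻¹ = 1 := ENNReal.mul_inv_cancel (by norm_num) (by norm_num)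
  have hθ1 : θ < 1 := by
    have h1 : (2 : ENNReal) ^ L * 2⁻¹ ^ L = 1 := by rw [← mul_pow, h2, one_pow]
    rw [hθ, ← h1]
    refine ENNReal.mul_lt_mul_left (by simp) (ENNReal.pow_ne_top (by simp)) ?_
    have : 2 ^ L - 1 < 2 ^ L := Nat.sub_lt (by positivity) one_pos
    exact_mod_cast this
  have hbound : ∀ j w, μ (D w) ≤ θ ^ j * 2⁻¹ ^ w.length := by
    intro j
    induction j with
    | zero =>
      intro w
      rw [pow_zero, one_mul]
      exact (measure_mono Set.inter_subset_right).trans (hausdorffMeasure_range_appendWord_le w)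
    | succ j ih =>
      have hgood : ∀ w, G w → μ (D w) ≤ θ ^ (j + 1) * 2⁻¹ ^ w.length := by
        intro w hw
        obtain ⟨c₀, hc₀⟩ := hG w hw
        have hsub : D w ⊆ ⋃ c ∈ Finset.univ.erase c₀, D (w ++ List.ofFn c) := by
          rintro _ ⟨hE, a, rfl⟩
          have ha : appendWord (w ++ List.ofFn fun i : Fin L => a i) (fun i => a (i + L))
              = appendWord w a := by rw [appendWord_append, appendWord_ofFn]
          refine Set.mem_biUnion (x := fun i : Fin L => a i) ?_ ⟨hE, fun i => a (i + L), ?_⟩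
          · refine Finset.mem_coe.2 (Finset.mem_erase.2 ⟨fun h => ?_, Finset.mem_univ _⟩)
            refine hc₀ (fun i => a (i + L)) ?_
            rw [← h, ha]
            exact hE
          · simp only [ha]
        calc μ (D w) ≤ ∑ c ∈ Finset.univ.erase c₀, μ (D (w ++ List.ofFn c)) :=
              (measure_mono hsub).trans (measure_biUnion_finset_le _ _)
          _ ≤ ∑ c ∈ Finset.univ.erase c₀, θ ^ j * 2⁻¹ ^ (w.length + L) :=
              Finset.sum_le_sum fun c _ => by simpa using ih (w ++ List.ofFn c)
          _ = θ ^ (j + 1) * 2⁻¹ ^ w.length := by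
              rw [Finset.sum_const, Finset.card_erase_of_mem (Finset.mem_univ _), Finset.card_univ,
                Fintype.card_fun, Fintype.card_bool, Fintype.card_fin, nsmul_eq_mul, pow_succ, hθ,
                pow_add]
              ring
      let S : ℕ → List Bool → Set ℝ := fun N w =>
        {x | x ∈ E ∧ ∃ a, cantorPoint (appendWord w a) = x ∧
          ∃ n ≤ N, G (w ++ List.ofFn fun i : Fin n => a i)}
      have hSD : ∀ N w, S N w ⊆ D w := by
        rintro N w x ⟨hx, a, ha, -⟩
        exact ⟨hx, a, ha⟩
      have hS : ∀ N w, μ (S N w) ≤ θ ^ (j + 1) * 2⁻¹ ^ w.length := by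
        intro N
        induction N with
        | zero =>
          intro w
          by_cases hw : G w
          · exact (measure_mono (hSD 0 w)).trans (hgood w hw)
          · have : S 0 w = ∅ := by
              refine Set.eq_empty_of_forall_notMem ?_
              rintro x ⟨-, a, -, n, hn, h⟩
              obtain rfl := Nat.le_zero.1 hn
              exact hw (by simpa using h)
            simp [this]
        | succ N ihN =>
          intro w
          by_cases hw : G w
          · exact (measure_mono (hSD _ w)).trans (hgood w hw)
          have hsub : S (N + 1) w ⊆ S N (w ++ [true]) ∪ S N (w ++ [false]) := by
            rintro x ⟨hx, a, rfl, n, hn, h⟩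
            cases n with
            | zero => exact absurd (by simpa using h) hw
            | succ n =>
              have key : cantorPoint (appendWord w a) ∈ S N (w ++ [a 0]) := by
                refine ⟨hx, fun i => a (i + 1), ?_, n, by omega, ?_⟩
                · rw [appendWord_append]
                  congr 2
                  simpa using appendWord_ofFn 1 a
                · simpa [List.ofFn_succ] using h
              cases ha : a 0
              · exact Or.inr (ha ▸ key)
              · exact Or.inl (ha ▸ key)
          calc μ (S (N + 1) w) ≤ μ (S N (w ++ [true])) + μ (S N (w ++ [false])) :=
                (measure_mono hsub).trans (measure_union_le _ _)
            _ ≤ θ ^ (j + 1) * 2⁻¹ ^ (w.length + 1) + θ ^ (j + 1) * 2⁻¹ ^ (w.length + 1) :=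
                add_le_add (by simpa using ihN (w ++ [true])) (by simpa using ihN (w ++ [false]))
            _ = θ ^ (j + 1) * 2⁻¹ ^ w.length * (2 * 2⁻¹) := by rw [pow_succ 2⁻¹]; ring
            _ = _ := by rw [h2, mul_one]
      intro w
      have hmono : Monotone fun N => S N w := by
        rintro M N hMN x ⟨hx, a, ha, n, hn, h⟩
        exact ⟨hx, a, ha, n, hn.trans hMN, h⟩
      have hsub : D w ⊆ ⋃ N, S N w := by
        rintro _ ⟨hE, a, rfl⟩
        obtain ⟨n, hn⟩ := hret w a hE
        exact Set.mem_iUnion.2 ⟨n, hE, a, rfl, n, le_rfl, hn⟩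
      refine (measure_mono hsub).trans ?_
      rw [hmono.measure_iUnion]
      exact iSup_le fun N => hS N w
  have hnil : ∀ j, μ (E ∩ Set.range cantorPoint) ≤ θ ^ j := by
    intro j
    have h := hbound j []
    have hD : D [] = E ∩ Set.range cantorPoint := by
      have : ∀ a, appendWord [] a = a := fun a => funext fun n => by simp [appendWord]
      simp only [D, this]
    simpa [hD] using h
  exact le_antisymm (ge_of_tendsto' (ENNReal.tendsto_pow_atTop_nhds_zero_of_lt_one hθ1) hnil) bot_le

/-! ### Conclusion -/

theorem continuous_cantorPoint : Continuous cantorPoint := by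
  refine continuous_tsum (u := fun i => 2 / 3 ^ (i + 1)) (fun i => ?_)
    hasSum_two_div_three_pow.summable fun i a => ?_
  · exact ((continuous_of_discreteTopology (f := cantorDigit)).comp (continuous_apply i)).div_const _
  · rw [Real.norm_of_nonneg (div_nonneg (cantorDigit_nonneg _) (by positivity))]
    gcongr
    exact cantorDigit_le_two _

theorem isCompact_middleThirdCantorSet : IsCompact middleThirdCantorSet :=
  middleThirdCantorSet_eq_range ▸ isCompact_range continuous_cantorPoint

theorem hausdorffMeasure_setOf_avoids_eq_zero {l : List ℕ} (hl : ∀ b ∈ l, 0 < b) :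
    (Measure.hausdorffMeasure (Real.log 2 / Real.log 3) : Measure ℝ)
      ({x | Irrational x ∧ ¬ ∃ m, ∀ i (hi : i < l.length), cfCoeff x (m + i + 1) = (l[i] : ℤ)} ∩
        Set.range cantorPoint) = 0 := by
  obtain ⟨e, -, he, L, hL⟩ := exists_uniform_hit (isOpen_cfCylinder l) (cfCylinder_nonempty l hl)
  refine hausdorffMeasure_inter_range_cantorPoint_eq_zero (G := fun w => walk w 1 ∈ thick e) (L := L)
    (fun w hw => ?_) fun w a ha => ?_
  · obtain ⟨a, ha⟩ := hL _ hw
    refine ⟨fun i => a i, fun b hb => hb.2 ?_⟩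
    have h1 := ha (appendWord (List.ofFn fun i : Fin L => a i) b) fun i hi =>
      appendWord_ofFn_apply (fun i : Fin L => a i) b ⟨i, hi⟩
    have h2 := mem_hitSet_of_walk w 1 h1
    rw [← appendWord_append] at h2
    refine exists_pattern_of_mem_hitSet hb.1 ?_ ?_ h2
    · exact (cantorPoint_nonneg _).lt_of_ne' hb.1.ne_zero
    · exact (cantorPoint_le_one _).lt_of_ne hb.1.ne_one
  · simp only [walk_append]
    refine exists_walk_mem_thick he (walk w 1) a fun p q hpq h0 => ?_
    rw [dev_walk, mul_eq_zero_iff_left (by positivity)] at h0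
    set x := cantorPoint (appendWord w a)
    have h1 : x * q - p = 0 := by simpa [dev, lat] using h0
    by_cases hq : q = 0
    · subst hq
      obtain rfl : p = 0 := by exact_mod_cast (by simpa using h1 : (p : ℝ) = 0)
      exact not_isCoprime_zero_zero hpq
    · exact (ha.1.mul_intCast hq).ne_int p (by linarith)

/-- with respect to the Hausdorff measure of dimension `log 2/log 3`
restricted to the middle-third Cantor set, the continued fraction expansion of almost
every point contains all patterns. -/
theorem stmt19 :
    ∀ᵐ x ∂((MeasureTheory.Measure.hausdorffMeasure
        (Real.log 2 / Real.log 3) : Measure ℝ).restrict middleThirdCantorSet),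
      ContainsAllPatterns x := by
  have hd : 0 < Real.log 2 / Real.log 3 :=
    div_pos (Real.log_pos (by norm_num)) (Real.log_pos (by norm_num))
  have := Measure.nullSingletonClass_hausdorff ℝ hd
  rw [ae_restrict_iff' isCompact_middleThirdCantorSet.measurableSet]
  have hirr : ∀ᵐ x ∂(Measure.hausdorffMeasure (Real.log 2 / Real.log 3) : Measure ℝ),
      Irrational x :=
    measure_eq_zero_iff_ae_notMem.1 ((Set.countable_range ((↑) : ℚ → ℝ)).measure_zero _)
  have hpat : ∀ᵐ x ∂(Measure.hausdorffMeasure (Real.log 2 / Real.log 3) : Measure ℝ),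
      ∀ l : List ℕ, (∀ b ∈ l, 0 < b) → Irrational x → x ∈ middleThirdCantorSet →
        ∃ m, ∀ i (hi : i < l.length), cfCoeff x (m + i + 1) = (l[i] : ℤ) := by
    refine ae_all_iff.2 fun l => ?_
    by_cases hl : ∀ b ∈ l, 0 < b
    · filter_upwards [measure_eq_zero_iff_ae_notMem.1 (hausdorffMeasure_setOf_avoids_eq_zero hl)]
        with x hx _ hxi hxC
      by_contra h
      exact hx ⟨⟨hxi, h⟩, middleThirdCantorSet_eq_range ▸ hxC⟩
    · exact Filter.Eventually.of_forall fun x h => absurd h hl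
  filter_upwards [hirr, hpat] with x hxi hx hxC k b hb
  obtain ⟨m, hm⟩ := hx (List.ofFn b) (fun c hc => by
    obtain ⟨i, rfl⟩ := List.mem_ofFn.1 hc
    exact hb i) hxi hxC
  exact ⟨m, fun i => by simpa using hm i (by simp)⟩
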